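/- Let Ω = (0,1)² ⊆ ℝ², let φ be the crystalline norm φ(ν) = |ν₁| + |ν₂| on ℝ², let m > 1, let u be a minimizer of problem (1) with mass m, let j̄ = ‖u‖_∞, and let E_j = {u ≥ j}. Then j̄ ∈ { ⌊((1+√2)/2)·m⌋ , ⌊((1+√2)/2)·m⌋ + 1 }, and cl(E_j) = cl(Ω^r) for all 1 ≤ j ≤ j̄, where r = √((1 − m/j̄)/2). -/

import Mathlib

open MeasureTheory Set ENNReal Filter

noncomputable section

/-- `φ` is a norm on `ℝⁿ` (represented as `Fin n → ℝ`). -/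
structure IsNorm {n : ℕ} (φ : (Fin n → ℝ) → ℝ) : Prop where
  nonneg : ∀ x, 0 ≤ φ x
  eq_zero_iff : ∀ x, φ x = 0 ↔ x = 0
  smul_eq : ∀ (a : ℝ) (x : Fin n → ℝ), φ (a • x) = |a| * φ x
  add_le : ∀ x y, φ (x + y) ≤ φ x + φ y

/-- The divergence of a vector field `η : ℝⁿ → ℝⁿ`. -/
def diverg {n : ℕ} (η : (Fin n → ℝ) → (Fin n → ℝ)) (x : Fin n → ℝ) : ℝ :=
  ∑ i, fderiv ℝ η x (Pi.single i 1) i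

/-- The anisotropic total variation `∫ φ*(Du)` of `u : ℝⁿ → ℝ`:
`sup { ∫ u div η dx : η ∈ C¹_c(ℝⁿ;ℝⁿ), φ(η(x)) ≤ 1 ∀ x }`, as an extended real. -/
def anisoTV {n : ℕ} (φ : (Fin n → ℝ) → ℝ) (u : (Fin n → ℝ) → ℝ) : ℝ≥0∞ :=
  ⨆ η ∈ {η : (Fin n → ℝ) → (Fin n → ℝ) |
      ContDiff ℝ 1 η ∧ HasCompactSupport η ∧ ∀ x, φ (η x) ≤ 1},
    ENNReal.ofReal (∫ x, u x * diverg η x)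

/-- `u ∈ BV(ℝⁿ)` (with respect to the anisotropic total variation). -/
def IsBV {n : ℕ} (φ : (Fin n → ℝ) → ℝ) (u : (Fin n → ℝ) → ℝ) : Prop :=
  Integrable u volume ∧ anisoTV φ u ≠ ⊤

/-- `u` is admissible for problem (1): `u ∈ BV(ℝⁿ)`, `u = 0` a.e. outside `Ω`,
`u` is a.e. `ℕ`-valued, and `∫_Ω u = m`. -/
def Admissible {n : ℕ} (φ : (Fin n → ℝ) → ℝ) (Ω : Set (Fin n → ℝ)) (m : ℝ)
    (u : (Fin n → ℝ) → ℝ) : Prop :=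
  IsBV φ u ∧ (∀ᵐ x ∂volume, x ∉ Ω → u x = 0) ∧
    (∀ᵐ x ∂volume, ∃ k : ℕ, u x = k) ∧ (∫ x in Ω, u x) = m

/-- `u` is a minimizer of problem (1). -/
def IsMinimizer {n : ℕ} (φ : (Fin n → ℝ) → ℝ) (Ω : Set (Fin n → ℝ)) (m : ℝ)
    (u : (Fin n → ℝ) → ℝ) : Prop :=
  Admissible φ Ω m u ∧ ∀ v, Admissible φ Ω m v → anisoTV φ u ≤ anisoTV φ v

/-- The anisotropic perimeter `P_φ(E)` of a set `E ⊆ ℝⁿ`. -/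
def anisoPerimeter {n : ℕ} (φ : (Fin n → ℝ) → ℝ) (E : Set (Fin n → ℝ)) : ℝ≥0∞ :=
  anisoTV φ (E.indicator (1 : (Fin n → ℝ) → ℝ))

/-- The Wulff ball `W_r(x) = {y : φ(y-x) < r}`. -/
def wulffBall {n : ℕ} (φ : (Fin n → ℝ) → ℝ) (x : Fin n → ℝ) (r : ℝ) : Set (Fin n → ℝ) :=
  {y | φ (y - x) < r}

/-- `E` satisfies the `rW_φ`-condition. -/
def rWCond {n : ℕ} (φ : (Fin n → ℝ) → ℝ) (E : Set (Fin n → ℝ)) (r : ℝ) : Prop :=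
  ∀ x ∈ frontier E, ∃ y, wulffBall φ y r ⊆ E ∧ x ∈ frontier (wulffBall φ y r)

/-- The Wulff plaquette `E^r`, the union of all Wulff balls of radius `r` contained
in `E` (with `E^0 = E`). -/
def plaquette {n : ℕ} (φ : (Fin n → ℝ) → ℝ) (E : Set (Fin n → ℝ)) (r : ℝ) :
    Set (Fin n → ℝ) :=
  if r = 0 then E else ⋃ (x) (_ : wulffBall φ x r ⊆ E), wulffBall φ x r

/-- `R_Ω`: the maximal `R > 0` such that some Wulff ball of radius `R` is contained in `Ω`. -/
def maxInradius {n : ℕ} (φ : (Fin n → ℝ) → ℝ) (Ω : Set (Fin n → ℝ)) : ℝ :=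
  sSup {R | 0 < R ∧ ∃ x, wulffBall φ x R ⊆ Ω}

/-- `r_Ω`: the maximal `r > 0` such that `Ω` satisfies the `rW_φ`-condition
(`0` if there is none, since `sSup ∅ = 0`). -/
def maxRollRadius {n : ℕ} (φ : (Fin n → ℝ) → ℝ) (Ω : Set (Fin n → ℝ)) : ℝ :=
  sSup {r | 0 < r ∧ rWCond φ Ω r}

/-- The set of points of Lebesgue density `1` of `E`. -/
def densityPoints {n : ℕ} (E : Set (Fin n → ℝ)) : Set (Fin n → ℝ) :=
  {x | Tendsto (fun r : ℝ => volume (E ∩ Metric.ball x r) / volume (Metric.ball x r))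
    (nhdsWithin 0 (Ioi 0)) (nhds 1)}

/-- `E` is a minimizer of problem (10): the constrained isoperimetric problem
minimizing `P_φ` among measurable subsets of `Ω` of prescribed measure `m`. -/
def IsIsopMinimizer {n : ℕ} (φ : (Fin n → ℝ) → ℝ) (Ω : Set (Fin n → ℝ)) (m : ℝ)
    (E : Set (Fin n → ℝ)) : Prop :=
  MeasurableSet E ∧ E ⊆ Ω ∧ (volume E).toReal = m ∧
    ∀ F, MeasurableSet F → F ⊆ Ω → (volume F).toReal = m →
      anisoPerimeter φ E ≤ anisoPerimeter φ F

/-- The Euclidean norm on `ℝ²`. -/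
def euclNorm (v : Fin 2 → ℝ) : ℝ := Real.sqrt (v 0 ^ 2 + v 1 ^ 2)

/-- The crystalline norm `φ(ν) = |ν₁| + |ν₂|` on `ℝ²`. -/
def crysNorm (v : Fin 2 → ℝ) : ℝ := |v 0| + |v 1|

/-- The open unit square `(0,1)² ⊆ ℝ²`. -/
def unitSquare : Set (Fin 2 → ℝ) := univ.pi fun _ => Ioo (0 : ℝ) 1

/-- The closed unit square `[0,1]² ⊆ ℝ²`. -/
def closedUnitSquare : Set (Fin 2 → ℝ) := univ.pi fun _ => Icc (0 : ℝ) 1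

/-- `j` is the essential supremum `‖u‖_∞` of `u`. -/
def IsEssSup (u : (Fin 2 → ℝ) → ℝ) (j : ℕ) : Prop :=
  (∀ᵐ x ∂volume, u x ≤ (j : ℝ)) ∧ ∀ c : ℝ, (∀ᵐ x ∂volume, u x ≤ c) → (j : ℝ) ≤ c

/-- The integral of `γ` along the segment from `x` to `x - R • v`. -/
def segmentIntegral {E : Type*} [AddCommGroup E] [Module ℝ E] (γ : E → ℝ) (v : E) (R : ℝ)
    (x : E) : ℝ :=
  ∫ σ in (0 : ℝ)..R, γ (x - σ • v)

section SegmentIntegral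

variable {E : Type*} [NormedAddCommGroup E] [NormedSpace ℝ E] {γ : E → ℝ}

theorem segmentIntegral_contDiff [MeasurableSpace E] [BorelSpace E]
    (hγ : ContDiff ℝ 1 γ) (hc : HasCompactSupport γ) (v : E) {R : ℝ} (hR : 0 ≤ R) :
    ContDiff ℝ 1 (segmentIntegral γ v R) := by
  let f : ℝ → E := fun σ => σ • v
  have hf : Continuous f := by fun_prop
  let μ : Measure E := Measure.map f (volume.restrict (Ioc 0 R))
  have : IsFiniteMeasure μ := by
    dsimp only [μ]
    infer_instance
  have h1 : LocallyIntegrable (fun _ : E => (1 : ℝ)) μ :=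
    (integrable_const (1 : ℝ)).locallyIntegrable
  have h2 := hc.contDiff_convolution_right (n := 1) (ContinuousLinearMap.lsmul ℝ ℝ) h1
    (by exact_mod_cast hγ)
  suffices h : segmentIntegral γ v R =
      convolution (fun _ : E => (1 : ℝ)) γ (ContinuousLinearMap.lsmul ℝ ℝ) μ by
    rw [h]
    exact_mod_cast h2
  ext x
  rw [segmentIntegral, intervalIntegral.integral_of_le hR, convolution_lsmul,
    integral_map hf.aemeasurable]
  · simp [f]
  · have := hγ.continuous
    simp only [one_smul]
    exact (Continuous.stronglyMeasurable_of_hasCompactSupport (f := fun t => γ (x - t))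
      (by fun_prop) (hc.comp_homeomorph (Homeomorph.subLeft x))).aestronglyMeasurable

theorem segmentIntegral_fderiv_apply [MeasurableSpace E] [BorelSpace E]
    (hγ : ContDiff ℝ 1 γ) (hc : HasCompactSupport γ) (v : E) {R : ℝ} (hR : 0 ≤ R) (x : E) :
    fderiv ℝ (segmentIntegral γ v R) x v = γ x - γ (x - R • v) := by
  have hd : DifferentiableAt ℝ (segmentIntegral γ v R) x :=
    (segmentIntegral_contDiff hγ hc v hR).differentiable one_ne_zero x
  have h1 : HasDerivAt (fun h : ℝ => segmentIntegral γ v R (x + h • v))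
      (fderiv ℝ (segmentIntegral γ v R) x v) 0 := by
    have := hd.hasFDerivAt.hasLineDerivAt v
    simpa [HasLineDerivAt] using this
  have hcont : Continuous fun τ : ℝ => γ (x + τ • v) := by
    have := hγ.continuous
    fun_prop
  have h2 : ∀ h : ℝ, segmentIntegral γ v R (x + h • v) =
      (∫ τ in (0 : ℝ)..h, γ (x + τ • v)) - ∫ τ in (0 : ℝ)..(h - R), γ (x + τ • v) := by
    intro h
    rw [intervalIntegral.integral_interval_sub_left (hcont.intervalIntegrable _ _)
      (hcont.intervalIntegrable _ _), segmentIntegral]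
    have := intervalIntegral.integral_comp_sub_left (a := 0) (b := R)
      (fun τ : ℝ => γ (x + τ • v)) h
    rw [sub_zero] at this
    rw [← this]
    congr 1
    ext σ
    congr 1
    module
  have h3 : HasDerivAt (fun h : ℝ => segmentIntegral γ v R (x + h • v))
      (γ (x + (0 : ℝ) • v) - γ (x + (0 - R) • v)) 0 := by
    have ha : HasDerivAt (fun h : ℝ => ∫ τ in (0 : ℝ)..h, γ (x + τ • v))
        (γ (x + (0 : ℝ) • v)) 0 :=
      intervalIntegral.integral_hasDerivAt_right (hcont.intervalIntegrable _ _)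
        (hcont.stronglyMeasurableAtFilter _ _) hcont.continuousAt
    have hb : HasDerivAt (fun h : ℝ => ∫ τ in (0 : ℝ)..h, γ (x + τ • v))
        (γ (x + (0 - R) • v)) (0 - R) :=
      intervalIntegral.integral_hasDerivAt_right (hcont.intervalIntegrable _ _)
        (hcont.stronglyMeasurableAtFilter _ _) hcont.continuousAt
    have hb' := hb.comp_sub_const 0 R
    exact (ha.sub hb').congr_of_eventuallyEq (Eventually.of_forall h2)
  rw [h1.unique h3]
  congr 2 <;> module

theorem segmentIntegral_hasCompactSupport (hc : HasCompactSupport γ) (v : E) {R : ℝ} (hR : 0 ≤ R) :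
    HasCompactSupport (segmentIntegral γ v R) := by
  have hK : IsCompact ((fun p : E × ℝ => p.1 + p.2 • v) '' (tsupport γ ×ˢ Icc 0 R)) :=
    (hc.isCompact.prod isCompact_Icc).image (by fun_prop)
  refine HasCompactSupport.intro hK fun x hx => ?_
  rw [segmentIntegral, intervalIntegral.integral_of_le hR]
  refine setIntegral_eq_zero_of_forall_eq_zero fun σ hσ => ?_
  by_contra h
  exact hx ⟨(x - σ • v, σ), ⟨subset_tsupport _ h, Ioc_subset_Icc_self hσ⟩, by simp⟩

end SegmentIntegral

/-- Half of the main diagonal of the unit square. -/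
def diagVec : Fin 2 → ℝ := ![1 / 2, 1 / 2]

/-- Half of the second diagonal of the unit square. -/
def antidiagVec : Fin 2 → ℝ := ![1 / 2, -(1 / 2)]

theorem diverg_eq_diag {η : (Fin 2 → ℝ) → (Fin 2 → ℝ)} {x : Fin 2 → ℝ}
    (hη : DifferentiableAt ℝ η x) :
    diverg η x = fderiv ℝ (fun y => η y 0 + η y 1) x diagVec +
      fderiv ℝ (fun y => η y 0 - η y 1) x antidiagVec := by
  have h := hη.hasFDerivAt
  have h0 : HasFDerivAt (fun y => η y 0) _ x := hasFDerivAt_pi'.1 h 0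
  have h1 : HasFDerivAt (fun y => η y 1) _ x := hasFDerivAt_pi'.1 h 1
  rw [(h0.fun_add h1).fderiv, (h0.fun_sub h1).fderiv]
  have e0 : (Pi.single 0 1 : Fin 2 → ℝ) = diagVec + antidiagVec := by
    ext i; fin_cases i <;> simp [diagVec, antidiagVec] <;> norm_num
  have e1 : (Pi.single 1 1 : Fin 2 → ℝ) = diagVec - antidiagVec := by
    ext i; fin_cases i <;> simp [diagVec, antidiagVec] <;> norm_num
  simp only [diverg, Fin.sum_univ_two, e0, e1, map_add, map_sub, Pi.add_apply, Pi.sub_apply]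
  simp
  ring

/-- The difference of the integrals of `γ` over the two halves of a long segment
with midpoint `x`. -/
def balancedIntegral (γ : (Fin 2 → ℝ) → ℝ) (v x : Fin 2 → ℝ) : ℝ :=
  segmentIntegral γ v 10 x - segmentIntegral γ (-v) 10 x

section Balanced

variable {γ : (Fin 2 → ℝ) → ℝ} (hγ : ContDiff ℝ 1 γ) (hs : ∀ x, γ x ≠ 0 → ‖x‖ ≤ 3)

include hs in
theorem hasCompactSupport_of_norm_le_three : HasCompactSupport γ :=
  HasCompactSupport.intro (isCompact_closedBall (0 : Fin 2 → ℝ) 3) fun x hx => by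
    by_contra h
    exact hx (by simpa using hs x h)

include hγ hs

theorem balancedIntegral_contDiff (v : Fin 2 → ℝ) : ContDiff ℝ 1 (balancedIntegral γ v) :=
  (segmentIntegral_contDiff hγ (hasCompactSupport_of_norm_le_three hs) v (by norm_num)).sub
    (segmentIntegral_contDiff hγ (hasCompactSupport_of_norm_le_three hs) (-v) (by norm_num))

omit hγ in
theorem balancedIntegral_hasCompactSupport (v : Fin 2 → ℝ) :
    HasCompactSupport (balancedIntegral γ v) :=
  (segmentIntegral_hasCompactSupport (hasCompactSupport_of_norm_le_three hs) v (by norm_num)).sub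
    (segmentIntegral_hasCompactSupport (hasCompactSupport_of_norm_le_three hs) (-v)
      (by norm_num))

theorem balancedIntegral_fderiv_apply {v : Fin 2 → ℝ} (hv : ‖v‖ = 1 / 2) {x : Fin 2 → ℝ}
    (hx : ‖x‖ ≤ 1) : fderiv ℝ (balancedIntegral γ v) x v = 2 * γ x := by
  have hc := hasCompactSupport_of_norm_le_three hs
  have d1 := (segmentIntegral_contDiff hγ hc v (R := 10) (by norm_num)).differentiable one_ne_zero x
  have d2 := (segmentIntegral_contDiff hγ hc (-v) (R := 10)
    (by norm_num)).differentiable one_ne_zero x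
  have key : ∀ w : Fin 2 → ℝ, ‖w‖ = 1 / 2 → γ (x - (10 : ℝ) • w) = 0 := by
    intro w hw
    by_contra h
    have h1 := hs _ h
    have h2 : ‖(10 : ℝ) • w‖ ≤ ‖x‖ + ‖x - (10 : ℝ) • w‖ := by
      simpa using norm_sub_le x (x - (10 : ℝ) • w)
    rw [norm_smul, hw] at h2
    norm_num at h2
    linarith
  have e1 := segmentIntegral_fderiv_apply hγ hc v (R := 10) (by norm_num) x
  have e2 := segmentIntegral_fderiv_apply hγ hc (-v) (R := 10) (by norm_num) x
  rw [key v hv, sub_zero] at e1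
  rw [key (-v) (by simpa using hv), sub_zero, map_neg] at e2
  have : fderiv ℝ (balancedIntegral γ v) x =
      fderiv ℝ (segmentIntegral γ v 10) x - fderiv ℝ (segmentIntegral γ (-v) 10) x :=
    fderiv_sub d1 d2
  rw [this, sub_apply]
  linarith

omit hs in
theorem abs_balancedIntegral_le (v : Fin 2 → ℝ) {x : Fin 2 → ℝ}
    (h : ∫ σ in (-10 : ℝ)..10, |γ (x + σ • v)| ≤ 1) : |balancedIntegral γ v x| ≤ 1 := by
  have hcont : Continuous fun τ : ℝ => |γ (x + τ • v)| := by
    have := hγ.continuous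
    fun_prop
  have b1 : |segmentIntegral γ v 10 x| ≤ ∫ σ in (-10 : ℝ)..0, |γ (x + σ • v)| := by
    refine (intervalIntegral.abs_integral_le_integral_abs (by norm_num)).trans (le_of_eq ?_)
    have := intervalIntegral.integral_comp_neg (a := 0) (b := 10)
      (fun σ : ℝ => |γ (x + σ • v)|)
    rw [neg_zero] at this
    rw [← this]
    congr 1
    ext σ
    congr 2
    module
  have b2 : |segmentIntegral γ (-v) 10 x| ≤ ∫ σ in (0 : ℝ)..10, |γ (x + σ • v)| := by
    refine (intervalIntegral.abs_integral_le_integral_abs (by norm_num)).trans (le_of_eq ?_)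
    congr 1
    ext σ
    congr 2
    module
  have := intervalIntegral.integral_add_adjacent_intervals
    (hcont.intervalIntegrable (μ := volume) (-10) 0) (hcont.intervalIntegrable 0 10)
  calc |balancedIntegral γ v x| ≤ _ := abs_sub _ _
    _ ≤ 1 := by linarith

end Balanced

theorem norm_diagVec : ‖diagVec‖ = 1 / 2 := by
  refine le_antisymm ((pi_norm_le_iff_of_nonneg (by norm_num)).2 fun i => ?_) ?_
  · fin_cases i <;> norm_num [diagVec]
  · simpa [diagVec] using norm_le_pi_norm diagVec 0

theorem norm_antidiagVec : ‖antidiagVec‖ = 1 / 2 := by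
  refine le_antisymm ((pi_norm_le_iff_of_nonneg (by norm_num)).2 fun i => ?_) ?_
  · fin_cases i <;> norm_num [antidiagVec]
  · simpa [antidiagVec] using norm_le_pi_norm antidiagVec 0

theorem norm_le_one_of_mem_unitSquare {x : Fin 2 → ℝ} (hx : x ∈ unitSquare) : ‖x‖ ≤ 1 := by
  refine (pi_norm_le_iff_of_nonneg zero_le_one).2 fun i => ?_
  have := hx i (mem_univ i)
  rw [Real.norm_of_nonneg this.1.le]
  exact this.2.le

theorem le_anisoTV_of_contDiff {u : (Fin 2 → ℝ) → ℝ}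
    (hu : ∀ᵐ x ∂volume, x ∉ unitSquare → u x = 0) {γ₁ γ₂ : (Fin 2 → ℝ) → ℝ}
    (h₁ : ContDiff ℝ 1 γ₁) (h₂ : ContDiff ℝ 1 γ₂)
    (hs₁ : ∀ x, γ₁ x ≠ 0 → ‖x‖ ≤ 3) (hs₂ : ∀ x, γ₂ x ≠ 0 → ‖x‖ ≤ 3)
    (hb₁ : ∀ x, ∫ σ in (-10 : ℝ)..10, |γ₁ (x + σ • diagVec)| ≤ 1)
    (hb₂ : ∀ x, ∫ σ in (-10 : ℝ)..10, |γ₂ (x + σ • antidiagVec)| ≤ 1) :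
    ENNReal.ofReal (∫ x, u x * (2 * γ₁ x + 2 * γ₂ x)) ≤ anisoTV crysNorm u := by
  set α := balancedIntegral γ₁ diagVec
  set β := balancedIntegral γ₂ antidiagVec
  have hα : ContDiff ℝ 1 α := balancedIntegral_contDiff h₁ hs₁ _
  have hβ : ContDiff ℝ 1 β := balancedIntegral_contDiff h₂ hs₂ _
  have hαc : HasCompactSupport α := balancedIntegral_hasCompactSupport hs₁ _
  have hβc : HasCompactSupport β := balancedIntegral_hasCompactSupport hs₂ _
  let η : (Fin 2 → ℝ) → (Fin 2 → ℝ) := fun x => ![(α x + β x) / 2, (α x - β x) / 2]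
  have hη : ContDiff ℝ 1 η := by
    refine contDiff_pi.2 fun i => ?_
    fin_cases i
    · exact (hα.add hβ).div_const 2
    · exact (hα.sub hβ).div_const 2
  have hηc : HasCompactSupport η := by
    refine HasCompactSupport.intro (hαc.isCompact.union hβc.isCompact) fun x hx => ?_
    have hx1 : α x = 0 := image_eq_zero_of_notMem_tsupport fun h => hx (Or.inl h)
    have hx2 : β x = 0 := image_eq_zero_of_notMem_tsupport fun h => hx (Or.inr h)
    ext i
    fin_cases i <;> simp [η, hx1, hx2]
  have hηb : ∀ x, crysNorm (η x) ≤ 1 := by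
    intro x
    have ha : |α x| ≤ 1 := abs_balancedIntegral_le h₁ _ (hb₁ x)
    have hb : |β x| ≤ 1 := abs_balancedIntegral_le h₂ _ (hb₂ x)
    rw [abs_le] at ha hb
    simp only [crysNorm, η, Matrix.cons_val_zero, Matrix.cons_val_one]
    rcases abs_cases ((α x + β x) / 2) with h | h <;>
      rcases abs_cases ((α x - β x) / 2) with h' | h' <;> linarith
  have hdiv : ∀ᵐ x, u x * diverg η x = u x * (2 * γ₁ x + 2 * γ₂ x) := by
    filter_upwards [hu] with x hx
    by_cases hxs : x ∈ unitSquare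
    · rw [diverg_eq_diag (hη.differentiable one_ne_zero x)]
      have e1 : (fun y => η y 0 + η y 1) = α := by ext y; simp [η]; ring
      have e2 : (fun y => η y 0 - η y 1) = β := by ext y; simp [η]; ring
      have hxn := norm_le_one_of_mem_unitSquare hxs
      rw [e1, e2, balancedIntegral_fderiv_apply h₁ hs₁ norm_diagVec hxn,
        balancedIntegral_fderiv_apply h₂ hs₂ norm_antidiagVec hxn]
    · simp [hx hxs]
  rw [← integral_congr_ae hdiv]
  exact le_iSup₂_of_le η ⟨hη, hηc, hηb⟩ le_rfl

/-- The convolution of `g` with the normalized bump function `f`. -/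
def mollify (f : ContDiffBump (0 : Fin 2 → ℝ)) (g : (Fin 2 → ℝ) → ℝ) : (Fin 2 → ℝ) → ℝ :=
  convolution (f.normed volume) g (ContinuousLinearMap.lsmul ℝ ℝ) volume

section Mollify

variable {f : ContDiffBump (0 : Fin 2 → ℝ)} {g : (Fin 2 → ℝ) → ℝ} {C : ℝ}

theorem integrable_of_le_of_support (hgm : Measurable g) (h0 : ∀ x, 0 ≤ g x) (hC : ∀ x, g x ≤ C)
    (hs : ∀ x, g x ≠ 0 → x ∈ unitSquare) : Integrable g := by
  have h1 : IntegrableOn g (Metric.closedBall 0 1) := by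
    refine Measure.integrableOn_of_bounded (M := C) measure_closedBall_lt_top.ne
      hgm.aestronglyMeasurable (Eventually.of_forall fun x => ?_)
    rw [Real.norm_of_nonneg (h0 x)]
    exact hC x
  refine (integrableOn_iff_integrable_of_support_subset fun x hx => ?_).1 h1
  simpa using norm_le_one_of_mem_unitSquare (hs x hx)

theorem mollify_contDiff (hg : Integrable g) : ContDiff ℝ 1 (mollify f g) :=
  f.hasCompactSupport_normed.contDiff_convolution_left (n := 1) _
    (by exact_mod_cast f.contDiff_normed) hg.locallyIntegrable

theorem mollify_integrand_integrable (hg : Integrable g) (x : Fin 2 → ℝ) :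
    Integrable fun t => f.normed volume t * g (x - t) :=
  f.hasCompactSupport_normed.convolutionExists_left (ContinuousLinearMap.lsmul ℝ ℝ)
    f.continuous_normed hg.locallyIntegrable x

theorem mollify_apply (x : Fin 2 → ℝ) :
    mollify f g x = ∫ t, f.normed volume t * g (x - t) := rfl

theorem mollify_nonneg (h0 : ∀ x, 0 ≤ g x) (x : Fin 2 → ℝ) : 0 ≤ mollify f g x :=
  integral_nonneg fun t => mul_nonneg (f.nonneg_normed t) (h0 _)

theorem mollify_le (hg : Integrable g) (hC : ∀ x, g x ≤ C) (x : Fin 2 → ℝ) :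
    mollify f g x ≤ C := by
  calc mollify f g x ≤ ∫ t, f.normed volume t * C := by
        refine integral_mono (mollify_integrand_integrable hg x)
          (f.integrable_normed.mul_const C) fun t => ?_
        exact mul_le_mul_of_nonneg_left (hC _) (f.nonneg_normed t)
    _ = C := by rw [integral_mul_const, f.integral_normed, one_mul]

theorem norm_le_three_of_mollify_ne_zero (hf : f.rOut ≤ 1)
    (hs : ∀ x, g x ≠ 0 → x ∈ unitSquare) (x : Fin 2 → ℝ) (hx : mollify f g x ≠ 0) :
    ‖x‖ ≤ 3 := by
  have h := support_convolution_subset (L := ContinuousLinearMap.lsmul ℝ ℝ) (μ := volume)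
    (f := f.normed volume) (g := g) hx
  obtain ⟨y, hy, z, hz, rfl⟩ := h
  rw [f.support_normed_eq, mem_ball_zero_iff] at hy
  have hz' := norm_le_one_of_mem_unitSquare (hs z hz)
  have := norm_add_le y z
  linarith

theorem integral_abs_mollify_le_one (hgm : Measurable g) (hg : Integrable g) (h0 : ∀ x, 0 ≤ g x)
    {v : Fin 2 → ℝ} (hb : ∀ x, ∫⁻ σ : ℝ, ENNReal.ofReal (g (x + σ • v)) ≤ 1) (x : Fin 2 → ℝ) :
    ∫ σ in (-10 : ℝ)..10, |mollify f g (x + σ • v)| ≤ 1 := by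
  have hcont : Continuous (mollify f g) := (mollify_contDiff hg).continuous
  rw [intervalIntegral.integral_of_le (by norm_num),
    integral_eq_lintegral_of_nonneg_ae (Eventually.of_forall fun σ => abs_nonneg _)
      (by fun_prop)]
  refine ENNReal.toReal_le_of_le_ofReal zero_le_one ?_
  rw [ENNReal.ofReal_one]
  have hpt : ∀ y, ENNReal.ofReal |mollify f g y| =
      ∫⁻ t, ENNReal.ofReal (f.normed volume t) * ENNReal.ofReal (g (y - t)) := by
    intro y
    rw [abs_of_nonneg (mollify_nonneg h0 y), mollify_apply, ofReal_integral_eq_lintegral_ofReal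
      (mollify_integrand_integrable hg y)
      (Eventually.of_forall fun t => mul_nonneg (f.nonneg_normed t) (h0 _))]
    exact lintegral_congr fun t => ENNReal.ofReal_mul (f.nonneg_normed t)
  have hfm : Measurable (f.normed volume) := f.continuous_normed.measurable
  calc ∫⁻ σ in Ioc (-10 : ℝ) 10, ENNReal.ofReal |mollify f g (x + σ • v)|
      ≤ ∫⁻ σ : ℝ, ENNReal.ofReal |mollify f g (x + σ • v)| := setLIntegral_le_lintegral _ _
    _ = ∫⁻ σ : ℝ, ∫⁻ t, ENNReal.ofReal (f.normed volume t) *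
          ENNReal.ofReal (g (x + σ • v - t)) := lintegral_congr fun σ => hpt _
    _ = ∫⁻ t, ∫⁻ σ : ℝ, ENNReal.ofReal (f.normed volume t) *
          ENNReal.ofReal (g (x + σ • v - t)) := by
        refine lintegral_lintegral_swap (Measurable.aemeasurable ?_)
        simp only [Function.uncurry_def]
        fun_prop
    _ = ∫⁻ t, ENNReal.ofReal (f.normed volume t) *
          ∫⁻ σ : ℝ, ENNReal.ofReal (g (x - t + σ • v)) := by
        refine lintegral_congr fun t => ?_
        rw [← lintegral_const_mul _ (by fun_prop)]
        refine lintegral_congr fun σ => ?_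
        rw [add_sub_right_comm]
    _ ≤ ∫⁻ t, ENNReal.ofReal (f.normed volume t) :=
        lintegral_mono fun t => mul_le_of_le_one_right' (hb _)
    _ = 1 := by
        rw [← ofReal_integral_eq_lintegral_ofReal f.integrable_normed
          (Eventually.of_forall f.nonneg_normed), f.integral_normed, ENNReal.ofReal_one]

end Mollify

theorem le_anisoTV_of_measurable {u : (Fin 2 → ℝ) → ℝ} (hui : Integrable u)
    (hu : ∀ᵐ x ∂volume, x ∉ unitSquare → u x = 0) {g₁ g₂ : (Fin 2 → ℝ) → ℝ} {C : ℝ}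
    (hm₁ : Measurable g₁) (hm₂ : Measurable g₂) (h₁ : ∀ x, 0 ≤ g₁ x) (h₂ : ∀ x, 0 ≤ g₂ x)
    (hC₁ : ∀ x, g₁ x ≤ C) (hC₂ : ∀ x, g₂ x ≤ C)
    (hs₁ : ∀ x, g₁ x ≠ 0 → x ∈ unitSquare) (hs₂ : ∀ x, g₂ x ≠ 0 → x ∈ unitSquare)
    (hb₁ : ∀ x, ∫⁻ σ : ℝ, ENNReal.ofReal (g₁ (x + σ • diagVec)) ≤ 1)
    (hb₂ : ∀ x, ∫⁻ σ : ℝ, ENNReal.ofReal (g₂ (x + σ • antidiagVec)) ≤ 1) :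
    ENNReal.ofReal (∫ x, u x * (2 * g₁ x + 2 * g₂ x)) ≤ anisoTV crysNorm u := by
  have hi₁ := integrable_of_le_of_support hm₁ h₁ hC₁ hs₁
  have hi₂ := integrable_of_le_of_support hm₂ h₂ hC₂ hs₂
  let f : ℕ → ContDiffBump (0 : Fin 2 → ℝ) := fun n =>
    ⟨(1 / 2) * (1 / ((n : ℝ) + 1)), 1 / ((n : ℝ) + 1), by positivity, by
      have : 0 < 1 / ((n : ℝ) + 1) := by positivity
      linarith⟩
  have hf : Tendsto (fun n => (f n).rOut) atTop (nhds 0) :=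
    tendsto_one_div_add_atTop_nhds_zero_nat
  have hf' : ∀ᶠ n in atTop, (f n).rOut ≤ 2 * (f n).rIn :=
    Eventually.of_forall fun n => by simp only [f]; linarith
  have hf1 : ∀ n, (f n).rOut ≤ 1 := fun n => by
    simp only [f]
    rw [div_le_one (by positivity)]
    linarith [Nat.cast_nonneg (α := ℝ) n]
  have t₁ := ContDiffBump.ae_convolution_tendsto_right_of_locallyIntegrable hf hf'
    hi₁.locallyIntegrable
  have t₂ := ContDiffBump.ae_convolution_tendsto_right_of_locallyIntegrable hf hf'
    hi₂.locallyIntegrable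
  have hlim : Tendsto (fun n => ∫ x, u x * (2 * mollify (f n) g₁ x + 2 * mollify (f n) g₂ x))
      atTop (nhds (∫ x, u x * (2 * g₁ x + 2 * g₂ x))) := by
    refine tendsto_integral_of_dominated_convergence (fun x => |u x| * (4 * C)) (fun n => ?_)
      (hui.abs.mul_const _) (fun n => Eventually.of_forall fun x => ?_) ?_
    · have c₁ := (mollify_contDiff (f := f n) hi₁).continuous
      have c₂ := (mollify_contDiff (f := f n) hi₂).continuous
      exact hui.aestronglyMeasurable.mul (by fun_prop)
    · rw [norm_mul, Real.norm_eq_abs, Real.norm_of_nonneg]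
      · have := mollify_le (f := f n) hi₁ hC₁ x
        have := mollify_le (f := f n) hi₂ hC₂ x
        gcongr
        linarith
      · have := mollify_nonneg (f := f n) h₁ x
        have := mollify_nonneg (f := f n) h₂ x
        positivity
    · filter_upwards [t₁, t₂] with x hx₁ hx₂
      exact ((hx₁.const_mul 2).add (hx₂.const_mul 2)).const_mul (u x)
  refine le_of_tendsto (ENNReal.tendsto_ofReal hlim) (Eventually.of_forall fun n => ?_)
  exact le_anisoTV_of_contDiff hu (mollify_contDiff hi₁) (mollify_contDiff hi₂)
    (norm_le_three_of_mollify_ne_zero (hf1 n) hs₁) (norm_le_three_of_mollify_ne_zero (hf1 n) hs₂)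
    (integral_abs_mollify_le_one hm₁ hi₁ h₁ hb₁) (integral_abs_mollify_le_one hm₂ hi₂ h₂ hb₂)

/-- Coordinates along the diagonals of the unit square, centred at its midpoint. -/
def tilt : ℝ × ℝ ≃ₜ (Fin 2 → ℝ) where
  toFun p := ![(1 + p.1 + p.2) / 2, (1 + p.1 - p.2) / 2]
  invFun x := (x 0 + x 1 - 1, x 0 - x 1)
  left_inv p := by ext <;> simp <;> ring
  right_inv x := by ext i; fin_cases i <;> simp
  continuous_toFun := by
    refine continuous_pi fun i => ?_
    fin_cases i <;> simp <;> fun_prop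
  continuous_invFun := by fun_prop

theorem tilt_apply (p : ℝ × ℝ) : tilt p = ![(1 + p.1 + p.2) / 2, (1 + p.1 - p.2) / 2] := rfl

theorem tilt_add_left (s s' t : ℝ) : tilt (s + s', t) = tilt (s, t) + s' • diagVec := by
  ext i; fin_cases i <;> simp [tilt_apply, diagVec] <;> ring

theorem tilt_add_right (s t t' : ℝ) : tilt (s, t + t') = tilt (s, t) + t' • antidiagVec := by
  ext i; fin_cases i <;> simp [tilt_apply, antidiagVec] <;> ring

theorem tilt_mem_unitSquare {p : ℝ × ℝ} : tilt p ∈ unitSquare ↔ |p.1| + |p.2| < 1 := by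
  simp only [unitSquare, tilt_apply, mem_univ_pi, Fin.forall_fin_two, Matrix.cons_val_zero,
    Matrix.cons_val_one, mem_Ioo]
  constructor
  · rintro ⟨⟨h1, h2⟩, h3, h4⟩
    rcases abs_cases p.1 with h | h <;> rcases abs_cases p.2 with h' | h' <;> linarith
  · intro h
    have := abs_le.1 (le_refl |p.1|)
    have := abs_le.1 (le_refl |p.2|)
    refine ⟨⟨?_, ?_⟩, ?_, ?_⟩ <;> linarith

theorem map_tilt_volume : Measure.map tilt volume = (2 : ℝ≥0∞) • volume := by
  let M : Matrix (Fin 2) (Fin 2) ℝ := !![1 / 2, 1 / 2; 1 / 2, -(1 / 2)]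
  have hdet : M.det = -(1 / 2) := by
    rw [Matrix.det_fin_two]
    norm_num [M]
  have h1 : Measure.map (MeasurableEquiv.finTwoArrow (α := ℝ)).symm volume = volume :=
    (volume_preserving_finTwoArrow ℝ).symm.map_eq
  have h2 : Measure.map (Matrix.toLin' M) volume = (2 : ℝ≥0∞) • volume := by
    rw [Real.map_matrix_volume_pi_eq_smul_volume_pi (by rw [hdet]; norm_num), hdet]
    norm_num
  have h3 : ⇑tilt = (fun x => ![1 / 2, 1 / 2] + x) ∘ (Matrix.toLin' M) ∘
      (MeasurableEquiv.finTwoArrow (α := ℝ)).symm := by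
    ext p i
    fin_cases i <;>
      simp [tilt_apply, M, MeasurableEquiv.finTwoArrow, MeasurableEquiv.piFinTwo,
        Matrix.vecHead, Matrix.vecTail] <;> ring
  have hM : Measurable (Matrix.toLin' M) :=
    (LinearMap.continuous_of_finiteDimensional _).measurable
  rw [h3, ← Measure.map_map (by fun_prop) (by fun_prop), ← Measure.map_map hM (by fun_prop), h1, h2,
    Measure.map_smul, map_add_left_eq_self]

theorem tilt_measurableEmbedding : MeasurableEmbedding tilt := tilt.measurableEmbedding

theorem integral_comp_tilt (f : (Fin 2 → ℝ) → ℝ) : ∫ p, f (tilt p) = 2 * ∫ x, f x := by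
  rw [← tilt_measurableEmbedding.integral_map f, map_tilt_volume, integral_smul_measure]
  simp

theorem volume_tilt_preimage (E : Set (Fin 2 → ℝ)) : volume (tilt ⁻¹' E) = 2 * volume E := by
  rw [← tilt_measurableEmbedding.map_apply, map_tilt_volume]
  simp

theorem ae_tilt_iff {P : (Fin 2 → ℝ) → Prop} : (∀ᵐ p, P (tilt p)) ↔ ∀ᵐ x, P x := by
  rw [← tilt_measurableEmbedding.ae_map_iff, map_tilt_volume,
    Measure.ae_ennreal_smul_measure_eq two_ne_zero]

theorem integrable_comp_tilt_iff {f : (Fin 2 → ℝ) → ℝ} :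
    Integrable (fun p => f (tilt p)) ↔ Integrable f := by
  have h := tilt_measurableEmbedding.integrable_map_iff (μ := volume) (g := f)
  rw [map_tilt_volume, integrable_smul_measure two_ne_zero (by simp)] at h
  exact h.symm

/-- The length of the horizontal slice of `A` at height `t`. -/
def sliceLength (A : Set (ℝ × ℝ)) (t : ℝ) : ℝ≥0∞ := volume ((fun s => (s, t)) ⁻¹' A)

/-- The heights at which `A` has a horizontal slice of positive length. -/
def shadow (A : Set (ℝ × ℝ)) : Set ℝ := {t | 0 < sliceLength A t}

theorem measurable_sliceLength {A : Set (ℝ × ℝ)} (hA : MeasurableSet A) :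
    Measurable (sliceLength A) :=
  measurable_measure_prodMk_right hA

theorem measurableSet_shadow {A : Set (ℝ × ℝ)} (hA : MeasurableSet A) :
    MeasurableSet (shadow A) :=
  measurableSet_lt measurable_const (measurable_sliceLength hA)

/-- On each horizontal line, the normalized indicator of the last of the sets `D 0, …, D (n - 1)`
whose slice is longer than `ε`. -/
def calibration (D : ℕ → Set (ℝ × ℝ)) (ε : ℝ≥0∞) : ℕ → ℝ × ℝ → ℝ≥0∞
  | 0, _ => 0
  | n + 1, p =>
    open Classical in
    if ε < sliceLength (D n) p.2 then (D n).indicator (fun q => (sliceLength (D n) q.2)⁻¹) p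
    else calibration D ε n p

section calibration

variable {D : ℕ → Set (ℝ × ℝ)} {ε : ℝ≥0∞}

theorem measurable_calibration (hD : ∀ j, MeasurableSet (D j)) (n : ℕ) :
    Measurable (calibration D ε n) := by
  induction n with
  | zero => exact measurable_const
  | succ n ih =>
    have h : Measurable fun p : ℝ × ℝ => sliceLength (D n) p.2 :=
      (measurable_sliceLength (hD n)).comp measurable_snd
    exact Measurable.ite (measurableSet_lt measurable_const h) (h.inv.indicator (hD n)) ih

theorem calibration_le (n : ℕ) (p : ℝ × ℝ) : calibration D ε n p ≤ ε⁻¹ := by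
  induction n with
  | zero => exact zero_le
  | succ n ih =>
    rw [calibration]
    split_ifs with h
    · by_cases hp : p ∈ D n
      · rw [indicator_of_mem hp]
        exact ENNReal.inv_le_inv.2 h.le
      · rw [indicator_of_notMem hp]
        exact zero_le
    · exact ih

theorem mem_of_calibration_ne_zero (hD : Antitone D) {n : ℕ} {p : ℝ × ℝ}
    (h : calibration D ε n p ≠ 0) : p ∈ D 0 := by
  induction n with
  | zero => exact absurd rfl h
  | succ n ih =>
    rw [calibration] at h
    split_ifs at h with h'
    · exact hD n.zero_le (mem_of_indicator_ne_zero h)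
    · exact ih h

theorem lintegral_slice_indicator {A : Set (ℝ × ℝ)} (hA : MeasurableSet A) (c : ℝ≥0∞) (t : ℝ) :
    ∫⁻ s, A.indicator (fun _ => c) (s, t) = c * sliceLength A t := by
  have hm : MeasurableSet ((fun s => (s, t)) ⁻¹' A) := hA.preimage (by fun_prop)
  rw [sliceLength, ← lintegral_indicator_const hm]
  rfl

theorem lintegral_calibration_le (hD : ∀ j, MeasurableSet (D j)) (n : ℕ) (t : ℝ) :
    ∫⁻ s, calibration D ε n (s, t) ≤ 1 := by
  induction n with
  | zero => simp [calibration]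
  | succ n ih =>
    by_cases h : ε < sliceLength (D n) t
    · have h1 : ∀ s, calibration D ε (n + 1) (s, t) =
          (D n).indicator (fun _ => (sliceLength (D n) t)⁻¹) (s, t) := fun s => by
        simp only [calibration, h, if_true]
        rfl
      simp_rw [h1, lintegral_slice_indicator (hD n)]
      exact ENNReal.inv_mul_le_one _
    · simpa only [calibration, h, if_false] using ih

theorem card_le_lintegral_calibration (hD : ∀ j, MeasurableSet (D j)) (hDa : Antitone D)
    (hfin : ∀ j t, sliceLength (D j) t ≠ ⊤) (n : ℕ) (t : ℝ) :
    ∑ j ∈ Finset.range n, {t | ε < sliceLength (D j) t}.indicator (fun _ => (1 : ℝ≥0∞)) t ≤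
      ∫⁻ s, (∑ j ∈ Finset.range n, (D j).indicator (fun _ => (1 : ℝ≥0∞)) (s, t)) *
        calibration D ε n (s, t) := by
  induction n with
  | zero => simp
  | succ n ih =>
    by_cases h : ε < sliceLength (D n) t
    · have h1 : ∀ s, (∑ j ∈ Finset.range (n + 1), (D j).indicator (fun _ => (1 : ℝ≥0∞)) (s, t)) *
          calibration D ε (n + 1) (s, t) =
          (D n).indicator (fun _ => ((n + 1 : ℕ) : ℝ≥0∞) * (sliceLength (D n) t)⁻¹) (s, t) := by
        intro s
        simp only [calibration, h, if_true]
        by_cases hs : (s, t) ∈ D n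
        · rw [indicator_of_mem hs, indicator_of_mem hs, Finset.sum_congr rfl fun j hj =>
            indicator_of_mem (hDa (Finset.mem_range_succ_iff.1 hj) hs) _]
          simp
        · simp [indicator_of_notMem hs]
      simp_rw [h1, lintegral_slice_indicator (hD n)]
      rw [mul_assoc, ENNReal.inv_mul_cancel (pos_of_gt h).ne' (hfin n t), mul_one]
      calc _ ≤ ∑ j ∈ Finset.range (n + 1), (1 : ℝ≥0∞) :=
            Finset.sum_le_sum fun j _ => indicator_le_self' (by simp) t
        _ = _ := by simp
    · rw [Finset.sum_range_succ, indicator_of_notMem (by exact h), add_zero]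
      refine ih.trans (lintegral_mono fun s => ?_)
      simp only [calibration, h, if_false]
      rw [Finset.sum_range_succ]
      gcongr
      exact le_self_add

theorem sum_measure_le_lintegral_calibration (hD : ∀ j, MeasurableSet (D j)) (hDa : Antitone D)
    (hfin : ∀ j t, sliceLength (D j) t ≠ ⊤) (n : ℕ) :
    ∑ j ∈ Finset.range n, volume {t | ε < sliceLength (D j) t} ≤
      ∫⁻ p, (∑ j ∈ Finset.range n, (D j).indicator (fun _ => (1 : ℝ≥0∞)) p) *
        calibration D ε n p := by
  have hm : ∀ j, MeasurableSet {t | ε < sliceLength (D j) t} := fun j =>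
    measurableSet_lt measurable_const (measurable_sliceLength (hD j))
  have hmeas : Measurable fun p => (∑ j ∈ Finset.range n,
      (D j).indicator (fun _ => (1 : ℝ≥0∞)) p) * calibration D ε n p :=
    (Finset.measurable_sum _ fun j _ => measurable_const.indicator (hD j)).mul
      (measurable_calibration hD n)
  rw [Measure.volume_eq_prod, lintegral_prod_symm' _ hmeas]
  calc _ = ∫⁻ t, ∑ j ∈ Finset.range n,
        {t | ε < sliceLength (D j) t}.indicator (fun _ => (1 : ℝ≥0∞)) t := by
        rw [lintegral_finsetSum _ fun j _ => measurable_const.indicator (hm j)]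
        refine Finset.sum_congr rfl fun j _ => ?_
        rw [lintegral_indicator_const (hm j), one_mul]
    _ ≤ _ := lintegral_mono fun t => card_le_lintegral_calibration hD hDa hfin n t

end calibration

/-- The image `{|s| + |t| < 1}` of the unit square in tilted coordinates. -/
theorem abs_add_abs_lt_of_mem {A : Set (Fin 2 → ℝ)} (hA : A ⊆ unitSquare) {p : ℝ × ℝ}
    (hp : p ∈ tilt ⁻¹' A) : |p.1| + |p.2| < 1 :=
  tilt_mem_unitSquare.1 (hA hp)

theorem sliceLength_lt_top {A : Set (ℝ × ℝ)} (hA : ∀ p ∈ A, |p.1| + |p.2| < 1) (t : ℝ) :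
    sliceLength A t < ⊤ := by
  refine (measure_mono (t := Ioo (-1 : ℝ) 1) fun s hs => ?_).trans_lt (by simp)
  have := hA _ hs
  have h2 := abs_nonneg t
  exact abs_lt.1 (by simp only at this; linarith)

theorem lintegral_add_left_calibration_le {D : ℕ → Set (ℝ × ℝ)} {ε : ℝ≥0∞}
    (hD : ∀ j, MeasurableSet (D j)) (n : ℕ) (s t : ℝ) :
    ∫⁻ σ : ℝ, ENNReal.ofReal (calibration D ε n (s + σ, t)).toReal ≤ 1 := by
  calc _ ≤ ∫⁻ σ, calibration D ε n (s + σ, t) := lintegral_mono fun _ => ofReal_toReal_le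
    _ = ∫⁻ σ, calibration D ε n (σ, t) :=
        lintegral_add_left_eq_self (fun σ => calibration D ε n (σ, t)) s
    _ ≤ 1 := lintegral_calibration_le hD n t

theorem sum_measure_sliceLength_le_anisoTV {u : (Fin 2 → ℝ) → ℝ} (hui : Integrable u)
    {A : ℕ → Set (Fin 2 → ℝ)} {n : ℕ} (hAm : ∀ j, MeasurableSet (A j)) (hAa : Antitone A)
    (hAs : ∀ j, A j ⊆ unitSquare)
    (hu : ∀ᵐ x, u x = ∑ j ∈ Finset.range n, (A j).indicator (fun _ => (1 : ℝ)) x)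
    {ε : ℝ≥0∞} (hε : ε ≠ 0) :
    ∑ j ∈ Finset.range n, (volume {t | ε < sliceLength (tilt ⁻¹' A j) t} +
      volume {t | ε < sliceLength (Prod.swap ⁻¹' (tilt ⁻¹' A j)) t}) ≤ anisoTV crysNorm u := by
  set D : ℕ → Set (ℝ × ℝ) := fun j => tilt ⁻¹' A j with hD
  set D' : ℕ → Set (ℝ × ℝ) := fun j => Prod.swap ⁻¹' D j with hD'
  have hDm : ∀ j, MeasurableSet (D j) := fun j => tilt.continuous.measurable (hAm j)
  have hDm' : ∀ j, MeasurableSet (D' j) := fun j => measurable_swap (hDm j)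
  have hDa : Antitone D := fun i j h => preimage_mono (hAa h)
  have hDa' : Antitone D' := fun i j h => preimage_mono (hDa h)
  have hDs : ∀ j, ∀ p ∈ D j, |p.1| + |p.2| < 1 := fun j p => abs_add_abs_lt_of_mem (hAs j)
  have hDs' : ∀ j, ∀ p ∈ D' j, |p.1| + |p.2| < 1 := fun j p hp => by
    rw [add_comm]; exact hDs j _ hp
  let G₁ : ℝ × ℝ → ℝ≥0∞ := calibration D ε n
  let G₂ : ℝ × ℝ → ℝ≥0∞ := fun p => calibration D' ε n p.swap
  have hG₁ : Measurable G₁ := measurable_calibration hDm n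
  have hG₂ : Measurable G₂ := (measurable_calibration hDm' n).comp measurable_swap
  have hε' : ε⁻¹ ≠ ⊤ := ENNReal.inv_ne_top.2 hε
  have hle₁ : ∀ p, G₁ p ≤ ε⁻¹ := calibration_le n
  have hle₂ : ∀ p, G₂ p ≤ ε⁻¹ := fun p => calibration_le n _
  have hmem₁ : ∀ x, (G₁ (tilt.symm x)).toReal ≠ 0 → x ∈ unitSquare := fun x hx => by
    have := mem_of_calibration_ne_zero hDa (fun h : G₁ (tilt.symm x) = 0 => hx (by
      rw [h, toReal_zero]))
    exact hAs 0 (by simpa [hD] using this)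
  have hmem₂ : ∀ x, (G₂ (tilt.symm x)).toReal ≠ 0 → x ∈ unitSquare := fun x hx => by
    have := mem_of_calibration_ne_zero hDa' (fun h : G₂ (tilt.symm x) = 0 => hx (by
      rw [h, toReal_zero]))
    exact hAs 0 (by simpa [hD', hD] using this)
  have hout : ∀ᵐ x ∂volume, x ∉ unitSquare → u x = 0 := by
    filter_upwards [hu] with x hx hxs
    rw [hx]
    exact Finset.sum_eq_zero fun j _ => indicator_of_notMem (fun h => hxs (hAs j h)) _
  have key := le_anisoTV_of_measurable hui hout (C := ε⁻¹.toReal)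
    (g₁ := fun x => (G₁ (tilt.symm x)).toReal) (g₂ := fun x => (G₂ (tilt.symm x)).toReal)
    (hG₁.comp tilt.symm.continuous.measurable).ennreal_toReal
    (hG₂.comp tilt.symm.continuous.measurable).ennreal_toReal
    (fun _ => toReal_nonneg) (fun _ => toReal_nonneg)
    (fun x => toReal_mono hε' (hle₁ _)) (fun x => toReal_mono hε' (hle₂ _)) hmem₁ hmem₂
    (fun x => by
      obtain ⟨⟨s, t⟩, rfl⟩ := tilt.surjective x
      simp_rw [← tilt_add_left, Homeomorph.symm_apply_apply]
      exact lintegral_add_left_calibration_le hDm n s t)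
    (fun x => by
      obtain ⟨⟨s, t⟩, rfl⟩ := tilt.surjective x
      simp_rw [← tilt_add_right, Homeomorph.symm_apply_apply]
      exact lintegral_add_left_calibration_le hDm' n t s)
  refine le_trans ?_ key
  have hval : ∫ x, u x * (2 * (G₁ (tilt.symm x)).toReal + 2 * (G₂ (tilt.symm x)).toReal) =
      ∫ p, (∑ j ∈ Finset.range n, (D j).indicator (fun _ => (1 : ℝ)) p) *
        ((G₁ p).toReal + (G₂ p).toReal) := by
    have h1 : ∀ x, u x * (2 * (G₁ (tilt.symm x)).toReal + 2 * (G₂ (tilt.symm x)).toReal) =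
      2 * (u x * ((G₁ (tilt.symm x)).toReal + (G₂ (tilt.symm x)).toReal)) := fun x => by ring
    simp_rw [h1]
    rw [integral_const_mul, ← integral_comp_tilt]
    refine integral_congr_ae ?_
    filter_upwards [ae_tilt_iff.2 hu] with p hp
    simp only [hp, Homeomorph.symm_apply_apply]
    rfl
  have hsumm : Measurable fun p => ∑ j ∈ Finset.range n, (D j).indicator (fun _ => (1 : ℝ)) p :=
    Finset.measurable_sum _ fun j _ => measurable_const.indicator (hDm j)
  have hsum0 : ∀ p, 0 ≤ ∑ j ∈ Finset.range n, (D j).indicator (fun _ => (1 : ℝ)) p := fun p =>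
    Finset.sum_nonneg fun j _ => indicator_nonneg (fun _ _ => zero_le_one) p
  have hcoe : ∀ p, ENNReal.ofReal (∑ j ∈ Finset.range n, (D j).indicator (fun _ => (1 : ℝ)) p) =
      ∑ j ∈ Finset.range n, (D j).indicator (fun _ => (1 : ℝ≥0∞)) p := fun p => by
    rw [ENNReal.ofReal_sum_of_nonneg fun j _ => indicator_nonneg (fun _ _ => zero_le_one) p]
    refine Finset.sum_congr rfl fun j _ => ?_
    by_cases hp : p ∈ D j <;> simp [hp]
  have hint : Integrable fun p => (∑ j ∈ Finset.range n, (D j).indicator (fun _ => (1 : ℝ)) p) *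
        ((G₁ p).toReal + (G₂ p).toReal) := by
    have hu' : Integrable fun p =>
        ∑ j ∈ Finset.range n, (D j).indicator (fun _ => (1 : ℝ)) p := by
      refine (integrable_comp_tilt_iff.2 hui).congr ?_
      filter_upwards [ae_tilt_iff.2 hu] with p hp
      rw [hp]
      rfl
    refine hu'.mul_bdd (c := ε⁻¹.toReal + ε⁻¹.toReal)
      (hG₁.ennreal_toReal.add hG₂.ennreal_toReal).aestronglyMeasurable (ae_of_all _ fun p => ?_)
    rw [Real.norm_of_nonneg (add_nonneg toReal_nonneg toReal_nonneg)]
    exact add_le_add (toReal_mono hε' (hle₁ p)) (toReal_mono hε' (hle₂ p))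
  rw [hval, ofReal_integral_eq_lintegral_ofReal hint (ae_of_all _ fun p =>
    mul_nonneg (hsum0 p) (add_nonneg toReal_nonneg toReal_nonneg))]
  have hpt : ∀ p, ENNReal.ofReal ((∑ j ∈ Finset.range n, (D j).indicator (fun _ => (1 : ℝ)) p) *
        ((G₁ p).toReal + (G₂ p).toReal)) =
      (∑ j ∈ Finset.range n, (D j).indicator (fun _ => (1 : ℝ≥0∞)) p) * G₁ p +
      (∑ j ∈ Finset.range n, (D j).indicator (fun _ => (1 : ℝ≥0∞)) p) * G₂ p := fun p => by
    rw [ENNReal.ofReal_mul (hsum0 p), hcoe, ENNReal.ofReal_add toReal_nonneg toReal_nonneg,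
      ofReal_toReal ((hle₁ p).trans_lt hε'.lt_top).ne,
      ofReal_toReal ((hle₂ p).trans_lt hε'.lt_top).ne, mul_add]
  simp_rw [hpt]
  have hsummE : Measurable fun p =>
      ∑ j ∈ Finset.range n, (D j).indicator (fun _ => (1 : ℝ≥0∞)) p :=
    Finset.measurable_sum _ fun j _ => measurable_const.indicator (hDm j)
  rw [lintegral_add_left (by exact hsummE.mul hG₁), Finset.sum_add_distrib]
  refine add_le_add (sum_measure_le_lintegral_calibration hDm hDa
    (fun j t => (sliceLength_lt_top (hDs j) t).ne) n) ?_
  refine (sum_measure_le_lintegral_calibration hDm' hDa'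
    (fun j t => (sliceLength_lt_top (hDs' j) t).ne) n).trans ?_
  exact ((Measure.measurePreserving_swap (μ := (volume : Measure ℝ))
    (ν := (volume : Measure ℝ))).lintegral_comp (hsummE.mul hG₂)).le

theorem tendsto_measure_sliceLength_gt {A : Set (ℝ × ℝ)} :
    Tendsto (fun k : ℕ => volume {t | ((k : ℝ≥0∞) + 1)⁻¹ < sliceLength A t}) atTop
      (nhds (volume (shadow A))) := by
  have h : shadow A = ⋃ k : ℕ, {t | ((k : ℝ≥0∞) + 1)⁻¹ < sliceLength A t} := by
    ext t
    simp only [shadow, mem_ofPred_eq, mem_iUnion]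
    refine ⟨fun ht => ?_, fun ⟨k, hk⟩ => pos_of_gt hk⟩
    obtain ⟨k, hk⟩ := ENNReal.exists_inv_nat_lt ht.ne'
    exact ⟨k, (ENNReal.inv_le_inv.2 le_self_add).trans_lt hk⟩
  rw [h]
  refine tendsto_measure_iUnion_atTop fun i j hij t ht => ?_
  refine lt_of_le_of_lt (ENNReal.inv_le_inv.2 ?_) (mem_ofPred_eq ▸ ht)
  gcongr

theorem sum_measure_shadow_le_anisoTV {u : (Fin 2 → ℝ) → ℝ} (hui : Integrable u)
    {A : ℕ → Set (Fin 2 → ℝ)} {n : ℕ} (hAm : ∀ j, MeasurableSet (A j)) (hAa : Antitone A)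
    (hAs : ∀ j, A j ⊆ unitSquare)
    (hu : ∀ᵐ x, u x = ∑ j ∈ Finset.range n, (A j).indicator (fun _ => (1 : ℝ)) x) :
    ∑ j ∈ Finset.range n, (volume (shadow (tilt ⁻¹' A j)) +
      volume (shadow (Prod.swap ⁻¹' (tilt ⁻¹' A j)))) ≤ anisoTV crysNorm u :=
  le_of_tendsto' (tendsto_finsetSum _ fun _ _ =>
    tendsto_measure_sliceLength_gt.add tendsto_measure_sliceLength_gt) fun _ =>
      sum_measure_sliceLength_le_anisoTV hui hAm hAa hAs hu
        (ENNReal.inv_ne_zero.2 (by finiteness))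

/-- The length of the slice at `s` of the square `{|s| + |t| < 1}` truncated to width `2 - 2b`. -/
def cap (b s : ℝ) : ℝ := min (2 - 2 * b) (2 * (1 - |s|))

theorem continuous_cap (b : ℝ) : Continuous (cap b) := by unfold cap; fun_prop

theorem integrableOn_cap (b : ℝ) {S : Set ℝ} (hS : S ⊆ Icc (-1) 1) : IntegrableOn (cap b) S :=
  (continuous_cap b).integrableOn_Icc.mono_set hS

theorem integral_cap {a b : ℝ} (hb : 0 ≤ b) (hab : a + b ≤ 1) :
    ∫ s in Ioo (-(1 - a)) (1 - a), cap b s = 2 - 2 * a ^ 2 - 2 * b ^ 2 := by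
  have hi : ∀ x y, IntervalIntegrable (cap b) volume x y := fun x y =>
    (continuous_cap b).intervalIntegrable x y
  have h1 : ∫ s in (-(1 - a))..(-b), cap b s = (1 - b) ^ 2 - a ^ 2 := by
    have : ∫ s in (-(1 - a))..(-b), cap b s = ∫ s in (-(1 - a))..(-b), (2 + 2 * s) := by
      refine intervalIntegral.integral_congr fun s hs => ?_
      rw [uIcc_of_le (by linarith)] at hs
      simp only [cap]
      rw [abs_of_nonpos (by linarith [hs.2]), min_eq_right (by linarith [hs.2])]
      ring
    rw [this, intervalIntegral.integral_add (by simp)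
      ((continuous_const_mul (2 : ℝ)).intervalIntegrable _ _),
      intervalIntegral.integral_const_mul, integral_id]
    simp
    ring
  have h2 : ∫ s in (-b)..b, cap b s = 2 * b * (2 - 2 * b) := by
    have : ∫ s in (-b)..b, cap b s = ∫ s in (-b)..b, (2 - 2 * b) := by
      refine intervalIntegral.integral_congr fun s hs => ?_
      rw [uIcc_of_le (by linarith)] at hs
      have := abs_le.2 hs
      simp only [cap]
      rw [min_eq_left (by linarith)]
    rw [this]
    simp
    ring
  have h3 : ∫ s in b..(1 - a), cap b s = (1 - b) ^ 2 - a ^ 2 := by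
    have : ∫ s in b..(1 - a), cap b s = ∫ s in b..(1 - a), (2 - 2 * s) := by
      refine intervalIntegral.integral_congr fun s hs => ?_
      rw [uIcc_of_le (by linarith)] at hs
      simp only [cap]
      rw [abs_of_nonneg (by linarith [hs.1]), min_eq_right (by linarith [hs.1])]
      ring
    rw [this, intervalIntegral.integral_sub (by simp)
      ((continuous_const_mul (2 : ℝ)).intervalIntegrable _ _),
      intervalIntegral.integral_const_mul, integral_id]
    simp
    ring
  rw [← integral_Ioc_eq_integral_Ioo, ← intervalIntegral.integral_of_le (by linarith),
    ← intervalIntegral.integral_add_adjacent_intervals (hi _ (-b)) (hi (-b) _),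
    ← intervalIntegral.integral_add_adjacent_intervals (hi (-b) b) (hi b _), h1, h2, h3]
  ring

section rearrangement

variable {S : Set ℝ} {a b : ℝ}

theorem integral_indicator_sub_cap (hS : MeasurableSet S) (hS1 : S ⊆ Icc (-1) 1) (ha : 0 ≤ a)
    (hb : 0 ≤ b) (hab : a + b ≤ 1) (hvol : volume.real S = 2 - 2 * a) :
    Integrable (fun s => (Ioo (-(1 - a)) (1 - a)).indicator (fun s => cap b s - 2 * a) s -
      S.indicator (fun s => cap b s - 2 * a) s) ∧
    ∫ s, ((Ioo (-(1 - a)) (1 - a)).indicator (fun s => cap b s - 2 * a) s -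
      S.indicator (fun s => cap b s - 2 * a) s) =
      2 - 2 * a ^ 2 - 2 * b ^ 2 - ∫ s in S, cap b s := by
  have hI : Ioo (-(1 - a)) (1 - a) ⊆ Icc (-1) 1 := fun s hs =>
    ⟨by linarith [hs.1], by linarith [hs.2]⟩
  have hc : ∀ {U : Set ℝ}, U ⊆ Icc (-1) 1 → IntegrableOn (fun _ => 2 * a) U := fun hU =>
    continuous_const.integrableOn_Icc.mono_set hU
  have h1 := (integrable_indicator_iff measurableSet_Ioo).2
    ((integrableOn_cap b hI).sub (hc hI))
  have h2 := (integrable_indicator_iff hS).2 ((integrableOn_cap b hS1).sub (hc hS1))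
  refine ⟨h1.sub h2, ?_⟩
  have e := integral_sub h1 h2
  rw [integral_indicator measurableSet_Ioo, integral_indicator hS] at e
  have e1 := integral_sub (integrableOn_cap b hI) (hc hI)
  have e2 := integral_sub (integrableOn_cap b hS1) (hc hS1)
  refine e.trans ?_
  simp only [Pi.sub_apply]
  rw [e1, e2, integral_cap hb hab, setIntegral_const, setIntegral_const, hvol,
    Real.volume_real_Ioo_of_le (by linarith)]
  simp only [smul_eq_mul]
  ring

theorem indicator_sub_cap_nonneg (hab : a + b ≤ 1) (s : ℝ) :
    0 ≤ (Ioo (-(1 - a)) (1 - a)).indicator (fun s => cap b s - 2 * a) s -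
      S.indicator (fun s => cap b s - 2 * a) s := by
  rw [sub_nonneg]
  by_cases h : s ∈ Ioo (-(1 - a)) (1 - a)
  · rw [indicator_of_mem h]
    refine indicator_apply_le' (fun _ => le_rfl) fun _ => ?_
    have := abs_lt.2 h
    rw [cap, sub_nonneg]
    exact le_min (by linarith) (by linarith)
  · rw [indicator_of_notMem h]
    refine indicator_apply_le' (fun _ => ?_) fun _ => le_rfl
    have : ¬ |s| < 1 - a := fun h' => h (abs_lt.1 h')
    rw [cap, sub_nonpos]
    exact (min_le_right _ _).trans (by linarith)

theorem setIntegral_cap_le (hS : MeasurableSet S) (hS1 : S ⊆ Icc (-1) 1) (ha : 0 ≤ a)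
    (hb : 0 ≤ b) (hab : a + b ≤ 1) (hvol : volume.real S = 2 - 2 * a) :
    ∫ s in S, cap b s ≤ 2 - 2 * a ^ 2 - 2 * b ^ 2 := by
  rw [← sub_nonneg, ← (integral_indicator_sub_cap hS hS1 ha hb hab hvol).2]
  exact integral_nonneg (indicator_sub_cap_nonneg hab)

theorem ae_eq_Ioo_of_le_setIntegral_cap (hS : MeasurableSet S) (hS1 : S ⊆ Icc (-1) 1)
    (ha : 0 ≤ a) (hb : 0 ≤ b) (hab : a + b < 1) (hvol : volume.real S = 2 - 2 * a)
    (h : 2 - 2 * a ^ 2 - 2 * b ^ 2 ≤ ∫ s in S, cap b s) :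
    S =ᵐ[volume] Ioo (-(1 - a)) (1 - a) := by
  obtain ⟨hint, heq⟩ := integral_indicator_sub_cap hS hS1 ha hb hab.le hvol
  have h0 := (integral_eq_zero_iff_of_nonneg (indicator_sub_cap_nonneg hab.le) hint).1
    (le_antisymm (heq.trans_le (by linarith)) (integral_nonneg (indicator_sub_cap_nonneg hab.le)))
  have hsub : Ioo (-(1 - a)) (1 - a) ≤ᵐ[volume] S := by
    filter_upwards [h0] with s hs hmem
    by_contra hn
    have hmem' : s ∈ Ioo (-(1 - a)) (1 - a) := hmem
    rw [indicator_of_mem hmem', indicator_of_notMem hn] at hs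
    have := abs_lt.2 hmem'
    have : 2 * a < cap b s := lt_min (by linarith) (by linarith)
    simp only [Pi.zero_apply] at hs
    linarith
  have hfin : volume S ≠ ⊤ := ((measure_mono hS1).trans_lt (by simp)).ne
  refine (ae_eq_of_ae_subset_of_measure_ge hsub ?_ measurableSet_Ioo.nullMeasurableSet hfin).symm
  rw [← ofReal_measureReal hfin, hvol, Real.volume_Ioo]
  exact ENNReal.ofReal_le_ofReal (by linarith)

end rearrangement

/-- The truncated square `{|s| < 1 - r, |t| < 1 - r, |s| + |t| < 1}`. -/
def tiltedPlaquette (r : ℝ) : Set (ℝ × ℝ) :=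
  {p | |p.1| < 1 - r ∧ |p.2| < 1 - r ∧ |p.1| + |p.2| < 1}

theorem isOpen_tiltedPlaquette (r : ℝ) : IsOpen (tiltedPlaquette r) := by
  have h1 : IsOpen {p : ℝ × ℝ | |p.1| < 1 - r} := isOpen_lt (by fun_prop) continuous_const
  have h2 : IsOpen {p : ℝ × ℝ | |p.2| < 1 - r} := isOpen_lt (by fun_prop) continuous_const
  have h3 : IsOpen {p : ℝ × ℝ | |p.1| + |p.2| < 1} := isOpen_lt (by fun_prop) continuous_const
  exact h1.inter (h2.inter h3)

theorem measureReal_tiltedPlaquette {r : ℝ} (hr0 : 0 ≤ r) (hr : r ≤ 1 / 2) :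
    volume.real (tiltedPlaquette r) = 2 - 4 * r ^ 2 := by
  have hcap : ∀ s ∈ Ioo (-(1 - r)) (1 - r), 0 ≤ cap r s := fun s hs => by
    have := abs_lt.2 hs
    exact le_min (by linarith) (by linarith)
  have hI : Ioo (-(1 - r)) (1 - r) ⊆ Icc (-1) 1 := fun s hs =>
    ⟨by linarith [hs.1], by linarith [hs.2]⟩
  have key : volume (tiltedPlaquette r) =
      ENNReal.ofReal (∫ s in Ioo (-(1 - r)) (1 - r), cap r s) := by
    rw [ofReal_integral_eq_lintegral_ofReal (integrableOn_cap r hI)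
      ((ae_restrict_iff' measurableSet_Ioo).2 (ae_of_all _ hcap)),
      ← lintegral_indicator measurableSet_Ioo, Measure.volume_eq_prod,
      Measure.prod_apply (isOpen_tiltedPlaquette r).measurableSet]
    refine lintegral_congr fun s => ?_
    by_cases hs : s ∈ Ioo (-(1 - r)) (1 - r)
    · have hs' := abs_lt.2 hs
      have : Prod.mk s ⁻¹' tiltedPlaquette r =
          Ioo (-(min (1 - r) (1 - |s|))) (min (1 - r) (1 - |s|)) := by
        ext t
        rw [mem_Ioo, ← abs_lt, lt_min_iff]
        simp only [tiltedPlaquette, mem_preimage, mem_ofPred_eq, hs', true_and]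
        exact and_congr_right fun _ => by rw [lt_sub_iff_add_lt, add_comm]
      rw [this, indicator_of_mem hs, Real.volume_Ioo, cap]
      congr 1
      rw [sub_neg_eq_add, ← two_mul, mul_min_of_nonneg _ _ zero_le_two]
      congr 1
      ring
    · rw [indicator_of_notMem hs]
      exact measure_mono_null (fun t ht => hs (abs_lt.1 ht.1)) measure_empty
  rw [measureReal_def, key, toReal_ofReal (setIntegral_nonneg measurableSet_Ioo hcap),
    integral_cap hr0 (by linarith)]
  ring

section slices

variable {A : Set (ℝ × ℝ)}

theorem forall_mem_swap_preimage (hs : ∀ p ∈ A, |p.1| + |p.2| < 1) :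
    ∀ p ∈ Prod.swap ⁻¹' A, |p.1| + |p.2| < 1 := fun p hp => by
  rw [add_comm]
  exact hs _ hp

theorem shadow_subset (hs : ∀ p ∈ A, |p.1| + |p.2| < 1) : shadow A ⊆ Ioo (-1) 1 := by
  intro t ht
  obtain ⟨s, hs'⟩ := nonempty_of_measure_ne_zero (ne_of_gt ht)
  have := hs _ hs'
  have h2 := abs_nonneg s
  exact abs_lt.1 (by simp only at this; linarith)

theorem measure_shadow_ne_top (hs : ∀ p ∈ A, |p.1| + |p.2| < 1) : volume (shadow A) ≠ ⊤ :=
  ((measure_mono (shadow_subset hs)).trans_lt (by simp)).ne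

theorem measureReal_shadow_le (hs : ∀ p ∈ A, |p.1| + |p.2| < 1) :
    volume.real (shadow A) ≤ 2 := by
  refine (measureReal_mono (shadow_subset hs) (by simp)).trans ?_
  rw [Real.volume_real_Ioo_of_le (by norm_num)]
  norm_num

theorem ae_mem_shadow (hA : MeasurableSet A) : ∀ᵐ p : ℝ × ℝ, p ∈ A → p.2 ∈ shadow A := by
  have hm : MeasurableSet {p : ℝ × ℝ | p ∈ A ∧ p.2 ∉ shadow A} :=
    hA.inter (measurable_snd (measurableSet_shadow hA).compl)
  have h0 : volume {p : ℝ × ℝ | p ∈ A ∧ p.2 ∉ shadow A} = 0 := by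
    rw [Measure.volume_eq_prod, Measure.prod_apply_symm hm, lintegral_eq_zero_iff
      (measurable_measure_prodMk_right hm)]
    refine ae_of_all _ fun t => ?_
    by_cases ht : t ∈ shadow A
    · simp [ht]
    · have h : sliceLength A t = 0 := by simpa [shadow] using ht
      exact measure_mono_null (fun s hs => hs.1) h
  filter_upwards [measure_eq_zero_iff_ae_notMem.1 h0] with p hp hpA
  by_contra hn
  exact hp ⟨hpA, hn⟩

theorem ae_mem_shadow_swap (hA : MeasurableSet A) :
    ∀ᵐ p : ℝ × ℝ, p ∈ A → p.1 ∈ shadow (Prod.swap ⁻¹' A) := by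
  have h := ae_mem_shadow (measurable_swap hA)
  have hq : Measure.QuasiMeasurePreserving (Prod.swap : ℝ × ℝ → ℝ × ℝ) volume volume :=
    (Measure.measurePreserving_swap (μ := (volume : Measure ℝ))
      (ν := (volume : Measure ℝ))).quasiMeasurePreserving
  filter_upwards [hq.ae h] with p hp hpA
  exact hp (by simpa using hpA)

theorem measureReal_le_mul (hA : MeasurableSet A) (hs : ∀ p ∈ A, |p.1| + |p.2| < 1) :
    volume.real A ≤ volume.real (shadow (Prod.swap ⁻¹' A)) * volume.real (shadow A) := by
  have hle : A ≤ᵐ[volume] (shadow (Prod.swap ⁻¹' A)) ×ˢ (shadow A) := by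
    filter_upwards [ae_mem_shadow hA, ae_mem_shadow_swap hA] with p h1 h2 hp
    exact ⟨h2 hp, h1 hp⟩
  have h1 := measure_shadow_ne_top hs
  have h2 := measure_shadow_ne_top (forall_mem_swap_preimage hs)
  have hprod := measure_mono_ae hle
  rw [Measure.volume_eq_prod, Measure.prod_prod] at hprod
  rw [measureReal_def, measureReal_def, measureReal_def, ← toReal_mul]
  exact toReal_mono (mul_ne_top h2 h1) hprod

theorem measureReal_le_setIntegral_cap (hA : MeasurableSet A)
    (hs : ∀ p ∈ A, |p.1| + |p.2| < 1) :
    volume.real A ≤ ∫ s in shadow (Prod.swap ⁻¹' A),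
      cap (1 - volume.real (shadow A) / 2) s := by
  set S := shadow (Prod.swap ⁻¹' A) with hS
  set b := 1 - volume.real (shadow A) / 2 with hb
  have hSm : MeasurableSet S := measurableSet_shadow (measurable_swap hA)
  have hSs := shadow_subset (forall_mem_swap_preimage hs)
  have hcap : ∀ s ∈ S, 0 ≤ cap b s := fun s hs' => by
    have := abs_lt.2 (hSs hs')
    exact le_min (by rw [hb]; linarith [measureReal_nonneg (μ := volume) (s := shadow A)])
      (by linarith)
  have hint : IntegrableOn (cap b) S := integrableOn_cap b (hSs.trans Ioo_subset_Icc_self)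
  have key : volume A ≤ ENNReal.ofReal (∫ s in S, cap b s) := by
    rw [ofReal_integral_eq_lintegral_ofReal hint ((ae_restrict_iff' hSm).2 (ae_of_all _ hcap)),
      ← lintegral_indicator hSm, Measure.volume_eq_prod, Measure.prod_apply hA]
    refine lintegral_mono_ae ?_
    have h1 := Measure.ae_ae_of_ae_prod (μ := (volume : Measure ℝ)) (ν := (volume : Measure ℝ))
      (ae_mem_shadow hA)
    filter_upwards [h1] with s h1s
    by_cases hsS : s ∈ S
    · rw [indicator_of_mem hsS, cap, ENNReal.ofReal_min]
      refine le_min ?_ ?_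
      · have : 2 - 2 * b = volume.real (shadow A) := by rw [hb]; ring
        rw [this, ofReal_measureReal (measure_shadow_ne_top hs)]
        exact measure_mono_ae h1s
      · have : Prod.mk s ⁻¹' A ⊆ Ioo (-(1 - |s|)) (1 - |s|) := fun t ht => by
          have := hs _ ht
          exact abs_lt.1 (by simp only at this; linarith)
        refine (measure_mono this).trans_eq ?_
        rw [Real.volume_Ioo]
        congr 1
        ring
    · rw [indicator_of_notMem hsS]
      exact not_lt.1 hsS
  have h0 : 0 ≤ ∫ s in S, cap b s := setIntegral_nonneg hSm hcap
  exact (toReal_mono ofReal_ne_top key).trans_eq (toReal_ofReal h0)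

end slices

/-- The largest area of a subset of the unit square whose two tilted shadows have
total length `4p`. -/
def areaProfile (p : ℝ) : ℝ := if p ≤ 1 / 2 then 2 * p ^ 2 else 1 - 2 * (1 - p) ^ 2

/-- A quarter of the total length of the two shadows of `A`. -/
def meanShadow (A : Set (ℝ × ℝ)) : ℝ :=
  (volume.real (shadow A) + volume.real (shadow (Prod.swap ⁻¹' A))) / 4

section profile

variable {A : Set (ℝ × ℝ)}

theorem measureReal_le_of_one_le (hA : MeasurableSet A) (hs : ∀ p ∈ A, |p.1| + |p.2| < 1)
    {a b : ℝ} (ha : volume.real (shadow (Prod.swap ⁻¹' A)) = 2 - 2 * a)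
    (hb : volume.real (shadow A) = 2 - 2 * b) (hab : a + b ≤ 1) :
    volume.real A ≤ 2 - 2 * a ^ 2 - 2 * b ^ 2 := by
  have h := measureReal_le_setIntegral_cap hA hs
  have hs' := forall_mem_swap_preimage hs
  have h1 := measureReal_shadow_le hs
  have h2 := measureReal_shadow_le hs'
  have hb' : 1 - volume.real (shadow A) / 2 = b := by rw [hb]; ring
  rw [hb'] at h
  exact h.trans (setIntegral_cap_le (measurableSet_shadow (measurable_swap hA))
    ((shadow_subset hs').trans Ioo_subset_Icc_self) (by linarith) (by linarith) hab ha)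

theorem shadow_swap_ae_eq (hA : MeasurableSet A) (hs : ∀ p ∈ A, |p.1| + |p.2| < 1)
    {r : ℝ} (hr : r < 1 / 2) (ha : volume.real (shadow (Prod.swap ⁻¹' A)) = 2 - 2 * r)
    (hb : volume.real (shadow A) = 2 - 2 * r) (hV : volume.real A = 2 - 4 * r ^ 2) :
    shadow (Prod.swap ⁻¹' A) =ᵐ[volume] Ioo (-(1 - r)) (1 - r) := by
  have h := measureReal_le_setIntegral_cap hA hs
  have hs' := forall_mem_swap_preimage hs
  have h1 := measureReal_shadow_le hs
  have hb' : 1 - volume.real (shadow A) / 2 = r := by rw [hb]; ring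
  rw [hb'] at h
  exact ae_eq_Ioo_of_le_setIntegral_cap (measurableSet_shadow (measurable_swap hA))
    ((shadow_subset hs').trans Ioo_subset_Icc_self) (b := r) (by linarith) (by linarith)
    (by linarith) ha (by linarith)

theorem meanShadow_nonneg (A : Set (ℝ × ℝ)) : 0 ≤ meanShadow A :=
  div_nonneg (add_nonneg measureReal_nonneg measureReal_nonneg) (by norm_num)

theorem meanShadow_le_one (hs : ∀ p ∈ A, |p.1| + |p.2| < 1) : meanShadow A ≤ 1 := by
  have h1 := measureReal_shadow_le hs
  have h2 := measureReal_shadow_le (forall_mem_swap_preimage hs)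
  rw [meanShadow]
  linarith

theorem measureReal_le_areaProfile (hA : MeasurableSet A) (hs : ∀ p ∈ A, |p.1| + |p.2| < 1) :
    volume.real A ≤ 2 * areaProfile (meanShadow A) := by
  have h1 := measureReal_le_mul hA hs
  have h2 := measureReal_le_of_one_le hA hs
    (a := 1 - volume.real (shadow (Prod.swap ⁻¹' A)) / 2)
    (b := 1 - volume.real (shadow A) / 2) (by ring) (by ring)
  rw [areaProfile, meanShadow]
  set σ := volume.real (shadow (Prod.swap ⁻¹' A))
  set τ := volume.real (shadow A)
  split_ifs with h
  · nlinarith [sq_nonneg (σ - τ)]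
  · have := h2 (by linarith)
    nlinarith [sq_nonneg (σ - τ)]

/-- Rigidity in `measureReal_le_areaProfile`. -/
theorem ae_eq_tiltedPlaquette (hA : MeasurableSet A) (hs : ∀ p ∈ A, |p.1| + |p.2| < 1)
    {r : ℝ} (hr : r < 1 / 2) (hp : meanShadow A = 1 - r)
    (hV : volume.real A = 2 - 4 * r ^ 2) : A =ᵐ[volume] tiltedPlaquette r := by
  have hs' := forall_mem_swap_preimage hs
  have hswap : Prod.swap ⁻¹' (Prod.swap ⁻¹' A) = A := by
    rw [← preimage_comp, Prod.swap_swap_eq, preimage_id]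
  have hVswap : volume.real (Prod.swap ⁻¹' A) = volume.real A :=
    congrArg ENNReal.toReal ((Measure.measurePreserving_swap (μ := (volume : Measure ℝ))
      (ν := (volume : Measure ℝ))).measure_preimage hA.nullMeasurableSet)
  obtain ⟨ha, hb⟩ : volume.real (shadow (Prod.swap ⁻¹' A)) = 2 - 2 * r ∧
      volume.real (shadow A) = 2 - 2 * r := by
    have h2 := measureReal_le_of_one_le hA hs
      (a := 1 - volume.real (shadow (Prod.swap ⁻¹' A)) / 2)
      (b := 1 - volume.real (shadow A) / 2) (by ring) (by ring)
    rw [meanShadow] at hp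
    have h3 := h2 (by linarith)
    have : (volume.real (shadow (Prod.swap ⁻¹' A)) - volume.real (shadow A)) ^ 2 ≤ 0 := by
      nlinarith
    have := pow_eq_zero_iff (two_ne_zero) |>.1 (le_antisymm this (sq_nonneg _))
    constructor <;> linarith
  have hS := shadow_swap_ae_eq hA hs hr ha hb hV
  have hT := shadow_swap_ae_eq (measurable_swap hA) hs' hr (by rwa [hswap]) ha
    (hVswap.trans hV)
  rw [hswap] at hT
  have hsub : A ≤ᵐ[volume] tiltedPlaquette r := by
    have hS' : ∀ᵐ p : ℝ × ℝ, p.1 ∈ shadow (Prod.swap ⁻¹' A) ↔ p.1 ∈ Ioo (-(1 - r)) (1 - r) :=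
      Measure.quasiMeasurePreserving_fst.ae hS.mem_iff
    have hT' : ∀ᵐ p : ℝ × ℝ, p.2 ∈ shadow A ↔ p.2 ∈ Ioo (-(1 - r)) (1 - r) :=
      Measure.quasiMeasurePreserving_snd.ae hT.mem_iff
    filter_upwards [ae_mem_shadow hA, ae_mem_shadow_swap hA, hS', hT'] with p h1 h2 h3 h4 hp
    exact ⟨abs_lt.2 (h3.1 (h2 hp)), abs_lt.2 (h4.1 (h1 hp)), hs p hp⟩
  have hr0 : 0 ≤ r := by linarith [meanShadow_le_one hs]
  have hK := measureReal_tiltedPlaquette hr0 hr.le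
  have hKfin : volume (tiltedPlaquette r) ≠ ⊤ := fun h => by
    rw [measureReal_def, h, toReal_top] at hK
    nlinarith
  refine ae_eq_of_ae_subset_of_measure_ge hsub ?_ hA.nullMeasurableSet hKfin
  rw [← toReal_le_toReal hKfin ((measure_mono_ae hsub).trans_lt hKfin.lt_top).ne]
  exact (hK.trans hV.symm).le

end profile

theorem areaProfile_of_lt {p : ℝ} (hp : p < 1 / 2) : areaProfile p = 2 * p ^ 2 :=
  if_pos hp.le

theorem areaProfile_of_le {p : ℝ} (hp : 1 / 2 ≤ p) : areaProfile p = 1 - 2 * (1 - p) ^ 2 := by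
  rw [areaProfile]
  split_ifs with h
  · obtain rfl : p = 1 / 2 := le_antisymm h hp
    norm_num
  · rfl

theorem areaProfile_add_lt {x y : ℝ} (hx : 0 < x) (hy : 0 < y) (hx' : x < 1 / 2)
    (hy' : y < 1 / 2) : areaProfile x + areaProfile y < areaProfile (x + y) := by
  rw [areaProfile_of_lt hx', areaProfile_of_lt hy']
  rcases lt_or_ge (x + y) (1 / 2) with h | h
  · rw [areaProfile_of_lt h]
    nlinarith [mul_pos hx hy]
  · rw [areaProfile_of_le h]
    nlinarith [mul_pos (sub_pos.2 hx') (sub_pos.2 hy')]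

theorem sum_areaProfile_eq {s : Multiset ℝ} (hs : ∀ p ∈ s, 1 / 2 ≤ p) (c : ℝ) :
    (s.map areaProfile).sum = (4 - 4 * c) * s.sum - (1 - 2 * c ^ 2) * s.card -
      2 * (s.map fun p => (p - c) ^ 2).sum := by
  induction s using Multiset.induction_on with
  | empty => simp
  | cons p s ih =>
    simp only [Multiset.map_cons, Multiset.sum_cons, Multiset.card_cons]
    rw [ih fun q hq => hs q (Multiset.mem_cons_of_mem hq),
      areaProfile_of_le (hs p (Multiset.mem_cons_self p s))]
    push_cast
    ring

theorem sum_sq_sub_nonneg (s : Multiset ℝ) (c : ℝ) :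
    0 ≤ (s.map fun p => (p - c) ^ 2).sum :=
  Multiset.sum_nonneg fun x hx => by
    obtain ⟨p, -, rfl⟩ := Multiset.mem_map.1 hx
    exact sq_nonneg _

theorem card_le_two_mul_sum {s : Multiset ℝ} (hs : ∀ p ∈ s, 1 / 2 ≤ p) :
    (s.card : ℝ) ≤ 2 * s.sum := by
  have := Multiset.card_nsmul_le_sum hs
  rw [nsmul_eq_mul] at this
  linarith

theorem sum_le_card_of_le_one {s : Multiset ℝ} (hs : ∀ p ∈ s, p ≤ 1) : s.sum ≤ s.card := by
  simpa using Multiset.sum_le_card_nsmul s 1 hs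

section optimal

variable {m Q : ℝ}

/-- Configurations without small levels. -/
theorem eq_replicate_of_forall_half_le (hm : 1 < m)
    (hQ : ∀ n : ℕ, 0 < n → Q ≤ n → n ≤ 2 * Q → n * (4 * Q - n) - 2 * Q ^ 2 ≤ m * n)
    {s : Multiset ℝ} (hs : ∀ p ∈ s, 1 / 2 ≤ p) (hs1 : ∀ p ∈ s, p ≤ 1) (hsum : s.sum = Q)
    (hH : m ≤ (s.map areaProfile).sum) :
    (s.map areaProfile).sum = m ∧ ∃ c, 1 / 2 ≤ c ∧ s = Multiset.replicate s.card c := by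
  have hk : 0 < s.card := by
    rw [Multiset.card_pos]
    rintro rfl
    simp at hH
    linarith
  have hk' : (0 : ℝ) < s.card := by exact_mod_cast hk
  have h2 := card_le_two_mul_sum hs
  have h1 := sum_le_card_of_le_one hs1
  have h3 := hQ _ hk (hsum ▸ h1) (hsum ▸ h2)
  have hc : Q / s.card * s.card = Q := div_mul_cancel₀ _ hk'.ne'
  set c := Q / s.card with hcdef
  have heq := sum_areaProfile_eq hs c
  have h0 := sum_sq_sub_nonneg s c
  rw [hsum] at heq h2
  rw [← hc] at heq h3 h2
  have h4 : (s.card : ℝ) * (4 * c - 1 - 2 * c ^ 2) ≤ m := by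
    refine le_of_mul_le_mul_right ?_ hk'
    linarith
  have h5 : (s.map fun p => (p - c) ^ 2).sum = 0 := by linarith
  refine ⟨by linarith, c, ?_, ?_⟩
  · refine le_of_mul_le_mul_right ?_ hk'
    linarith
  · rw [Multiset.eq_replicate_card]
    intro p hp
    have hle := Multiset.single_le_sum (s := s.map fun p => (p - c) ^ 2) (fun x hx => by
      obtain ⟨p, -, rfl⟩ := Multiset.mem_map.1 hx
      exact sq_nonneg _) _ (Multiset.mem_map_of_mem (fun p => (p - c) ^ 2) hp)
    rw [h5] at hle
    have := pow_eq_zero_iff (two_ne_zero) |>.1 (le_antisymm hle (sq_nonneg _))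
    linarith

/-- A configuration with exactly one small level is not optimal. -/
theorem sum_areaProfile_cons_lt (hm : 1 < m)
    (hQ : ∀ n : ℕ, 0 < n → Q ≤ n → n ≤ 2 * Q → n * (4 * Q - n) - 2 * Q ^ 2 ≤ m * n)
    {x : ℝ} {s : Multiset ℝ} (hx : 0 < x) (hx' : x < 1 / 2) (hs : ∀ p ∈ s, 1 / 2 ≤ p)
    (hs1 : ∀ p ∈ s, p ≤ 1) (hsum : x + s.sum = Q) :
    areaProfile x + (s.map areaProfile).sum < m := by
  rw [areaProfile_of_lt hx']
  rcases Nat.eq_zero_or_pos s.card with hk | hk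
  · rw [Multiset.card_eq_zero] at hk
    subst hk
    simp only [Multiset.map_zero, Multiset.sum_zero]
    nlinarith
  by_contra! hH
  have hk' : (1 : ℝ) ≤ s.card := by exact_mod_cast hk
  have hk0 : (0 : ℝ) < s.card := by linarith
  have h2 := card_le_two_mul_sum hs
  have h1 := sum_le_card_of_le_one hs1
  set q := s.sum / s.card with hq
  have hR : s.sum = q * s.card := by rw [hq, div_mul_cancel₀ _ hk0.ne']
  have heq := sum_areaProfile_eq hs q
  have h0 := sum_sq_sub_nonneg s q
  rw [hR] at heq h1 h2
  rw [hR] at hsum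
  have hq1 : q ≤ 1 := le_of_mul_le_mul_right (by linarith) hk0
  have hq2 : 1 / 2 ≤ q := le_of_mul_le_mul_right (by linarith) hk0
  generalize hkdef : s.card = k at *
  rcases lt_or_ge (q + x) 1 with h | h
  · have h3 := hQ k hk (by nlinarith) (by nlinarith)
    have h4 : m * k ≤ (2 * x ^ 2 + k * (4 * q - 1 - 2 * q ^ 2)) * k :=
      mul_le_mul_of_nonneg_right (by linarith) hk0.le
    rw [← hsum] at h3
    have h5 : (k : ℝ) * (2 * (1 - q) - x) ≤ x := by
      refine le_of_mul_le_mul_left ?_ hx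
      nlinarith
    nlinarith
  · have h3 := hQ (k + 1) k.succ_pos (by push_cast; nlinarith) (by push_cast; nlinarith)
    push_cast at h3
    have h4 : m * (k + 1) ≤ (2 * x ^ 2 + k * (4 * q - 1 - 2 * q ^ 2)) * (k + 1) :=
      mul_le_mul_of_nonneg_right (by linarith) (by linarith)
    rw [← hsum] at h3
    have h5 : 2 * k * (q - x) ^ 2 ≤ (k + 1) * (1 - 2 * x) ^ 2 := by nlinarith
    have h6 : (1 - 2 * x) ^ 2 ≤ (q - x) ^ 2 := pow_le_pow_left₀ (by linarith) (by linarith) 2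
    have h7 : 0 < (1 - 2 * x) ^ 2 := pow_pos (by linarith) 2
    obtain rfl | hk2 : k = 1 ∨ 2 ≤ k := by omega
    · have h8 : (q - x) ^ 2 ≤ (1 - 2 * x) ^ 2 := by push_cast at h5; linarith
      have h9 : q - x ≤ 1 - 2 * x := le_of_sq_le_sq h8 (by linarith)
      have hqx : q = 1 - x := by linarith
      push_cast at heq
      rw [hqx] at heq
      rw [hqx] at h0
      nlinarith
    · have hk2' : (2 : ℝ) ≤ k := by exact_mod_cast hk2
      nlinarith

theorem eq_replicate_of_le_sum_areaProfile (hm : 1 < m)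
    (hQ : ∀ n : ℕ, 0 < n → Q ≤ n → n ≤ 2 * Q → n * (4 * Q - n) - 2 * Q ^ 2 ≤ m * n)
    (s : Multiset ℝ) (hs : ∀ p ∈ s, 0 < p ∧ p ≤ 1) (hsum : s.sum = Q)
    (hH : m ≤ (s.map areaProfile).sum) :
    (s.map areaProfile).sum = m ∧ ∃ c, 1 / 2 ≤ c ∧ s = Multiset.replicate s.card c := by
  induction hk : s.card using Nat.strong_induction_on generalizing s with
  | _ k ih =>
    rw [← hk]
    classical
    have hsplit := Multiset.filter_add_not (fun p : ℝ => p < 1 / 2) s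
    set b := s.filter fun p => ¬ p < 1 / 2 with hb
    have hbs : ∀ p ∈ b, 1 / 2 ≤ p := fun p hp => not_lt.1 (Multiset.mem_filter.1 hp).2
    have hbs1 : ∀ p ∈ b, p ≤ 1 := fun p hp => (hs p (Multiset.mem_filter.1 hp).1).2
    have has : ∀ p ∈ s.filter fun p => p < 1 / 2, 0 < p ∧ p < 1 / 2 := fun p hp =>
      ⟨(hs p (Multiset.mem_filter.1 hp).1).1, (Multiset.mem_filter.1 hp).2⟩
    generalize (s.filter fun p => p < 1 / 2) = a at hsplit has
    induction a using Multiset.induction_on with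
    | empty =>
      rw [zero_add] at hsplit
      rw [hsplit] at hbs hbs1
      exact eq_replicate_of_forall_half_le hm hQ hbs hbs1 hsum hH
    | cons x a _ =>
      induction a using Multiset.induction_on with
      | empty =>
        have hx := has x (by simp)
        have := sum_areaProfile_cons_lt hm hQ hx.1 hx.2 hbs hbs1
          (by rw [← hsum, ← hsplit]; simp)
        rw [← hsplit] at hH
        simp at hH
        linarith
      | cons y a _ =>
        exfalso
        have hx := has x (by simp)
        have hy := has y (by simp)
        have hlt := areaProfile_add_lt hx.1 hy.1 hx.2 hy.2
        have hcard : ((x + y) ::ₘ (a + b)).card < k := by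
          rw [← hk, ← hsplit]
          simp
        rw [← hsplit] at hH hsum hs
        simp only [Multiset.cons_add, Multiset.map_cons, Multiset.sum_cons] at hH hsum
        have h := (ih _ hcard ((x + y) ::ₘ (a + b)) (fun p hp => ?_) ?_ ?_ rfl).1
        · simp only [Multiset.map_cons, Multiset.sum_cons] at h
          linarith
        · rcases Multiset.mem_cons.1 hp with rfl | hp
          · exact ⟨by linarith, by linarith⟩
          · exact hs p (by simp only [Multiset.cons_add, Multiset.mem_cons, hp, or_true])
        · rw [Multiset.sum_cons]
          linarith
        · simp only [Multiset.map_cons, Multiset.sum_cons]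
          linarith

end optimal

theorem sqrt_rollRadius_le_half {m n : ℝ} (hn : 0 < n) (h2 : n ≤ 2 * m) :
    Real.sqrt ((1 - m / n) / 2) ≤ 1 / 2 := by
  refine Real.sqrt_le_iff.2 ⟨by norm_num, ?_⟩
  have : 1 / 2 ≤ m / n := by rw [le_div_iff₀ hn]; linarith
  linarith

theorem sq_sqrt_rollRadius {m n : ℝ} (hn : 0 < n) (h1 : m ≤ n) :
    Real.sqrt ((1 - m / n) / 2) ^ 2 = (1 - m / n) / 2 := by
  refine Real.sq_sqrt ?_
  have : m / n ≤ 1 := by rwa [div_le_one hn]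
  linarith

/-- Comparison with the equal-level configurations in a form free of square roots. -/
theorem competitor_bound {m Q : ℝ} (hm : 1 < m)
    (hF : ∀ n : ℕ, m ≤ n → n ≤ 2 * m → Q ≤ n * (1 - Real.sqrt ((1 - m / n) / 2)))
    (n : ℕ) (hn : 0 < n) (h2 : n ≤ 2 * Q) :
    n * (4 * Q - n) - 2 * Q ^ 2 ≤ m * n := by
  have hn' : (0 : ℝ) < n := by exact_mod_cast hn
  have hQm : Q ≤ m := by
    have ha := Nat.lt_floor_add_one m
    have hb := Nat.floor_le (show 0 ≤ m by linarith)
    have hle : m ≤ (⌊m⌋₊ + 1 : ℕ) := by push_cast; exact ha.le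
    have hle2 : ((⌊m⌋₊ + 1 : ℕ) : ℝ) ≤ 2 * m := by push_cast; linarith
    refine (hF (⌊m⌋₊ + 1) hle hle2).trans ?_
    generalize ((⌊m⌋₊ + 1 : ℕ) : ℝ) = k at *
    have hk : 0 < k := by linarith
    have e1 := sqrt_rollRadius_le_half hk hle2
    have e2 := sq_sqrt_rollRadius hk hle
    have e3 := Real.sqrt_nonneg ((1 - m / k) / 2)
    set ρ := Real.sqrt ((1 - m / k) / 2)
    have e4 : m / k = 1 - 2 * ρ ^ 2 := by linarith
    rw [div_eq_iff hk.ne'] at e4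
    rw [e4, mul_comm]
    exact mul_le_mul_of_nonneg_right (by nlinarith) hk.le
  rcases lt_or_ge (n : ℝ) m with h | h
  · nlinarith [mul_nonneg (sub_nonneg.2 h.le) hn'.le, sq_nonneg (n - Q)]
  · have h3 := hF n h (by linarith)
    have e2 := sq_sqrt_rollRadius hn' h
    have e3 := Real.sqrt_nonneg ((1 - m / n) / 2)
    set ρ := Real.sqrt ((1 - m / n) / 2)
    have e4 : m / n = 1 - 2 * ρ ^ 2 := by linarith
    rw [div_eq_iff hn'.ne'] at e4
    have h5 : n * ρ ≤ n - Q := by linarith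
    have h6 : (n * ρ) ^ 2 ≤ (n - Q) ^ 2 := pow_le_pow_left₀ (by positivity) h5 2
    rw [e4]
    nlinarith

theorem level_count_bounds {m c : ℝ} {N : ℕ} (hm : 1 < m) (hc : 1 / 2 ≤ c) (hc1 : c ≤ 1)
    (hmN : m = N * (1 - 2 * (1 - c) ^ 2))
    (hQ : ∀ n : ℕ, 0 < n → N * c ≤ n → n ≤ 2 * (N * c) →
      n * (4 * (N * c) - n) - 2 * (N * c) ^ 2 ≤ m * n) :
    1 / 2 < c ∧ (N - 1 : ℝ) ≤ (1 + Real.sqrt 2) / 2 * m ∧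
      (1 + Real.sqrt 2) / 2 * m < N + 1 := by
  have hN1 : (1 : ℝ) < N := by nlinarith [sq_nonneg (1 - c)]
  have hN : 1 < N := by exact_mod_cast hN1
  obtain ⟨k, rfl⟩ : ∃ k, N = k + 2 := ⟨N - 2, by omega⟩
  have hk : (0 : ℝ) ≤ k := k.cast_nonneg
  push_cast at *
  have hup : 2 * (k + 2) * c ^ 2 ≤ k + 3 := by
    rcases le_or_gt ((k : ℝ) + 3) (2 * ((k + 2) * c)) with h | h
    · have := hQ (k + 3) (by omega) (by push_cast; nlinarith) (by push_cast; exact h)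
      push_cast at this
      rw [hmN] at this
      refine le_of_mul_le_mul_left ?_ (show (0 : ℝ) < k + 2 by linarith)
      nlinarith
    · nlinarith
  have hlow : (k : ℝ) + 1 ≤ 2 * (k + 2) * c ^ 2 := by
    rcases le_or_gt ((k + 2) * c) ((k : ℝ) + 1) with h | h
    · have := hQ (k + 1) (by omega) (by push_cast; exact h) (by push_cast; nlinarith)
      push_cast at this
      rw [hmN] at this
      refine le_of_mul_le_mul_left ?_ (show (0 : ℝ) < k + 2 by linarith)
      nlinarith
    · have h' : ((k : ℝ) + 1) ^ 2 ≤ ((k + 2) * c) ^ 2 := pow_le_pow_left₀ (by linarith) h.le 2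
      refine le_of_mul_le_mul_left ?_ (show (0 : ℝ) < k + 2 by linarith)
      nlinarith
  have hc2 : 1 / 2 < c := by
    refine lt_of_le_of_ne hc fun h => ?_
    rw [← h] at hlow hmN
    nlinarith
  have hw : Real.sqrt 2 ^ 2 = 2 := Real.sq_sqrt (by norm_num)
  have hw0 : 1.4 < Real.sqrt 2 := Real.lt_sqrt_of_sq_lt (by norm_num)
  have hw1 : Real.sqrt 2 < 1.5 := (Real.sqrt_lt' (by norm_num)).2 (by norm_num)
  set w := Real.sqrt 2
  refine ⟨hc2, ?_, ?_⟩
  · rw [hmN]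
    rcases le_or_gt (w * c) 1 with h | h
    · have : 2 * c ^ 2 ≤ (1 + w) / 2 * (1 - 2 * (1 - c) ^ 2) := by
        have hcw : c ≤ w / 2 := by nlinarith
        have h1 : 0 ≤ (w / 2 - c) * ((3 + w) * c - (2 + w) / 2) :=
          mul_nonneg (by linarith) (by nlinarith)
        linear_combination h1 + (c / 2 - 1 / 4) * hw
      nlinarith
    · have : 1 ≤ (1 + w) / 2 * (1 - 2 * (1 - c) ^ 2) := by
        have hcw : w / 2 ≤ c := by nlinarith
        have h1 : 0 ≤ (1 + w) * ((c - w / 2) * (2 - w / 2 - c)) :=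
          mul_nonneg (by linarith) (mul_nonneg (by linarith) (by linarith))
        linear_combination h1 + (w / 4 - 3 / 4) * hw
      nlinarith
  · rw [hmN]
    have : (1 + w) / 2 * (1 - 2 * (1 - c) ^ 2) ≤ 1 / 2 + c ^ 2 := by
      have h1 : 0 ≤ (2 + w) * (c - w / 2) ^ 2 := mul_nonneg (by linarith) (sq_nonneg _)
      linear_combination h1 + ((2 + w) / 4 - c) * hw
    nlinarith

theorem level_structure {m Q : ℝ} (hm : 1 < m)
    (hF : ∀ n : ℕ, m ≤ n → n ≤ 2 * m → Q ≤ n * (1 - Real.sqrt ((1 - m / n) / 2)))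
    (s : Multiset ℝ) (hs : ∀ p ∈ s, 0 < p ∧ p ≤ 1) (hsum : s.sum = Q)
    (hH : m ≤ (s.map areaProfile).sum) :
    (s.map areaProfile).sum = m ∧ Real.sqrt ((1 - m / s.card) / 2) < 1 / 2 ∧
      (∀ p ∈ s, p = 1 - Real.sqrt ((1 - m / s.card) / 2)) ∧
      (s.card - 1 : ℝ) ≤ (1 + Real.sqrt 2) / 2 * m ∧
      (1 + Real.sqrt 2) / 2 * m < s.card + 1 := by
  have hQ : ∀ n : ℕ, 0 < n → Q ≤ n → n ≤ 2 * Q → n * (4 * Q - n) - 2 * Q ^ 2 ≤ m * n :=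
    fun n hn _ h2 => competitor_bound hm hF n hn h2
  obtain ⟨h1, c, hc, hrep⟩ := eq_replicate_of_le_sum_areaProfile hm hQ s hs hsum hH
  have hpos : 0 < s.card := by
    rw [Multiset.card_pos]
    rintro rfl
    simp at hH
    linarith
  have hpos' : (0 : ℝ) < s.card := by exact_mod_cast hpos
  have hmem : c ∈ s := by
    rw [hrep]
    exact Multiset.mem_replicate.2 ⟨hpos.ne', rfl⟩
  have hmN : m = s.card * (1 - 2 * (1 - c) ^ 2) := by
    rw [← h1, hrep, Multiset.map_replicate, Multiset.sum_replicate, Multiset.card_replicate,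
      areaProfile_of_le hc, nsmul_eq_mul]
  have hQN : Q = s.card * c := by
    rw [← hsum, hrep, Multiset.sum_replicate, Multiset.card_replicate, nsmul_eq_mul]
  rw [hQN] at hQ
  have hc1 := (hs c hmem).2
  obtain ⟨h2, h3, h4⟩ := level_count_bounds hm hc hc1 hmN hQ
  have hr : Real.sqrt ((1 - m / s.card) / 2) = 1 - c := by
    have : m / s.card = 1 - 2 * (1 - c) ^ 2 := by
      rw [div_eq_iff hpos'.ne', mul_comm]
      exact hmN
    rw [this, show (1 - (1 - 2 * (1 - c) ^ 2)) / 2 = (1 - c) ^ 2 by ring,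
      Real.sqrt_sq (by linarith)]
  refine ⟨h1, by linarith, fun p hp => ?_, h3, h4⟩
  rw [hr, _root_.sub_sub_cancel]
  exact Multiset.eq_of_mem_replicate (hrep ▸ hp)

theorem swap_preimage_tiltedPlaquette (r : ℝ) :
    Prod.swap ⁻¹' tiltedPlaquette r = tiltedPlaquette r := by
  ext p
  simp only [tiltedPlaquette, mem_preimage, mem_ofPred_eq, Prod.fst_swap, Prod.snd_swap]
  rw [add_comm |p.2|]
  tauto

theorem setIntegral_tiltedPlaquette_deriv_le {r : ℝ} (hr0 : 0 ≤ r) (hr : r ≤ 1)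
    {f D : ℝ × ℝ → ℝ} (hD : Continuous D) (hf : ∀ p, |f p| ≤ 1)
    (hfD : ∀ s t, HasDerivAt (fun s => f (s, t)) (D (s, t)) s) :
    ∫ p in tiltedPlaquette r, D p ≤ 4 * (1 - r) := by
  have hK := (isOpen_tiltedPlaquette r).measurableSet
  have hsub : tiltedPlaquette r ⊆ Icc (-1) 1 ×ˢ Icc (-1) 1 := fun p hp => by
    have h1 := abs_lt.1 hp.1
    have h2 := abs_lt.1 hp.2.1
    exact ⟨⟨by linarith, by linarith⟩, ⟨by linarith, by linarith⟩⟩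
  have hint : Integrable ((tiltedPlaquette r).indicator D) (volume.prod volume) := by
    rw [← Measure.volume_eq_prod, integrable_indicator_iff hK]
    exact (hD.continuousOn.integrableOn_compact (isCompact_Icc.prod isCompact_Icc)).mono_set hsub
  rw [← integral_indicator hK, Measure.volume_eq_prod, integral_prod_symm _ hint]
  have hle : ∀ t, ∫ s, (tiltedPlaquette r).indicator D (s, t) ≤
      (Ioo (-(1 - r)) (1 - r)).indicator (fun _ => (2 : ℝ)) t := by
    intro t
    by_cases ht : t ∈ Ioo (-(1 - r)) (1 - r)
    · have ht' := abs_lt.2 ht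
      rw [indicator_of_mem ht]
      set c := min (1 - r) (1 - |t|)
      have hc : 0 ≤ c := le_min (by linarith) (by linarith)
      have e : (fun s => (tiltedPlaquette r).indicator D (s, t)) =
          (Ioo (-c) c).indicator fun s => D (s, t) := by
        ext s
        have : (s, t) ∈ tiltedPlaquette r ↔ s ∈ Ioo (-c) c := by
          rw [mem_Ioo, ← abs_lt, lt_min_iff]
          simp only [tiltedPlaquette, mem_ofPred_eq, ht', true_and]
          exact and_congr_right fun _ => by rw [lt_sub_iff_add_lt]
        by_cases h : s ∈ Ioo (-c) c
        · rw [indicator_of_mem h, indicator_of_mem (this.2 h)]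
        · rw [indicator_of_notMem h, indicator_of_notMem fun h' => h (this.1 h')]
      rw [e, integral_indicator measurableSet_Ioo, ← integral_Ioc_eq_integral_Ioo,
        ← intervalIntegral.integral_of_le (by linarith),
        intervalIntegral.integral_eq_sub_of_hasDerivAt (fun s _ => hfD s t)
          (by have : Continuous fun s => D (s, t) := by fun_prop
              exact this.intervalIntegrable _ _)]
      have h1 := abs_le.1 (hf (c, t))
      have h2 := abs_le.1 (hf (-c, t))
      linarith
    · rw [indicator_of_notMem ht]
      refine le_of_eq (integral_eq_zero_of_ae (ae_of_all _ fun s => ?_))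
      exact indicator_of_notMem (fun h => ht (abs_lt.1 h.2.1)) _
  refine (integral_mono hint.integral_prod_right ?_ hle).trans ?_
  · exact (integrable_indicator_iff measurableSet_Ioo).2 (integrableOn_const (by simp))
  · rw [integral_indicator measurableSet_Ioo, setIntegral_const, Real.volume_real_Ioo_of_le
      (by linarith)]
    simp only [smul_eq_mul]
    linarith

theorem hasDerivAt_comp_tilt_left {γ : (Fin 2 → ℝ) → ℝ} (hγ : Differentiable ℝ γ) (s t : ℝ) :
    HasDerivAt (fun s => γ (tilt (s, t))) (fderiv ℝ γ (tilt (s, t)) diagVec) s := by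
  have h : HasDerivAt (fun s => tilt (s, t)) diagVec s := by
    have e : (fun s => tilt (s, t)) = fun s => tilt (0, t) + s • diagVec := by
      ext1 s
      rw [← tilt_add_left, zero_add]
    rw [e]
    simpa using ((hasDerivAt_id s).smul_const diagVec).const_add (tilt (0, t))
  exact (hγ _).hasFDerivAt.comp_hasDerivAt s h

theorem hasDerivAt_comp_tilt_right {γ : (Fin 2 → ℝ) → ℝ} (hγ : Differentiable ℝ γ) (s t : ℝ) :
    HasDerivAt (fun t => γ (tilt (s, t))) (fderiv ℝ γ (tilt (s, t)) antidiagVec) t := by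
  have h : HasDerivAt (fun t => tilt (s, t)) antidiagVec t := by
    have e : (fun t => tilt (s, t)) = fun t => tilt (s, 0) + t • antidiagVec := by
      ext1 s
      rw [← tilt_add_right, zero_add]
    rw [e]
    simpa using ((hasDerivAt_id t).smul_const antidiagVec).const_add (tilt (s, 0))
  exact (hγ _).hasFDerivAt.comp_hasDerivAt t h

/-- The function equal to `c` on the truncated square and to `0` elsewhere. -/
def plateau (c r : ℝ) : (Fin 2 → ℝ) → ℝ :=
  (tilt.symm ⁻¹' tiltedPlaquette r).indicator fun _ => c

theorem plateau_tilt (c r : ℝ) (p : ℝ × ℝ) :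
    plateau c r (tilt p) = (tiltedPlaquette r).indicator (fun _ => c) p := by
  have h : tilt p ∈ tilt.symm ⁻¹' tiltedPlaquette r ↔ p ∈ tiltedPlaquette r := by simp
  by_cases hp : p ∈ tiltedPlaquette r
  · rw [plateau, indicator_of_mem (h.2 hp), indicator_of_mem hp]
  · rw [plateau, indicator_of_notMem (mt h.1 hp), indicator_of_notMem hp]

theorem integral_plateau_mul_diverg_le {c r : ℝ} (hc : 0 ≤ c) (hr0 : 0 ≤ r) (hr : r ≤ 1)
    {η : (Fin 2 → ℝ) → (Fin 2 → ℝ)} (hη : ContDiff ℝ 1 η) (hb : ∀ x, crysNorm (η x) ≤ 1) :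
    ∫ x, plateau c r x * diverg η x ≤ c * (4 - 4 * r) := by
  have h0 : ContDiff ℝ 1 fun y => η y 0 := contDiff_pi.1 hη 0
  have h1 : ContDiff ℝ 1 fun y => η y 1 := contDiff_pi.1 hη 1
  set α : (Fin 2 → ℝ) → ℝ := fun y => η y 0 + η y 1
  set β : (Fin 2 → ℝ) → ℝ := fun y => η y 0 - η y 1
  have hα : ContDiff ℝ 1 α := h0.add h1
  have hβ : ContDiff ℝ 1 β := h0.sub h1
  set D₁ : ℝ × ℝ → ℝ := fun p => fderiv ℝ α (tilt p) diagVec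
  set D₂ : ℝ × ℝ → ℝ := fun p => fderiv ℝ β (tilt p) antidiagVec
  have hD₁ : Continuous D₁ :=
    ((hα.continuous_fderiv one_ne_zero).comp tilt.continuous).clm_apply continuous_const
  have hD₂ : Continuous D₂ :=
    ((hβ.continuous_fderiv one_ne_zero).comp tilt.continuous).clm_apply continuous_const
  have i₁ : ∫ p in tiltedPlaquette r, D₁ p ≤ 4 * (1 - r) :=
    setIntegral_tiltedPlaquette_deriv_le hr0 hr (f := fun p => α (tilt p)) hD₁
      (fun p => (abs_add_le _ _).trans (hb _))
      (hasDerivAt_comp_tilt_left (hα.differentiable one_ne_zero))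
  have i₂ : ∫ p in tiltedPlaquette r, D₂ p ≤ 4 * (1 - r) := by
    have h := setIntegral_tiltedPlaquette_deriv_le hr0 hr (f := fun p => β (tilt p.swap))
      (D := fun p => D₂ p.swap) (hD₂.comp continuous_swap)
      (fun p => (abs_sub _ _).trans (hb _))
      (fun s t => hasDerivAt_comp_tilt_right (hβ.differentiable one_ne_zero) t s)
    have hsw : MeasurePreserving (Prod.swap : ℝ × ℝ → ℝ × ℝ) volume volume :=
      Measure.measurePreserving_swap
    have := hsw.setIntegral_preimage_emb MeasurableEquiv.prodComm.measurableEmbedding D₂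
      (tiltedPlaquette r)
    rw [swap_preimage_tiltedPlaquette] at this
    rwa [this] at h
  have hint : ∀ {D : ℝ × ℝ → ℝ}, Continuous D → IntegrableOn D (tiltedPlaquette r) := by
    intro D hD
    refine (hD.continuousOn.integrableOn_compact ((isCompact_Icc (a := (-1 : ℝ)) (b := 1)).prod
      (isCompact_Icc (a := (-1 : ℝ)) (b := 1)))).mono_set fun p hp => ?_
    have h1 := abs_lt.1 hp.1
    have h2 := abs_lt.1 hp.2.1
    exact ⟨⟨by linarith, by linarith⟩, ⟨by linarith, by linarith⟩⟩
  have e := integral_comp_tilt fun x => plateau c r x * diverg η x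
  have e' : (fun p => plateau c r (tilt p) * diverg η (tilt p)) =
      (tiltedPlaquette r).indicator fun p => c * (D₁ p + D₂ p) := by
    ext p
    rw [plateau_tilt, diverg_eq_diag (hη.differentiable one_ne_zero _)]
    by_cases hp : p ∈ tiltedPlaquette r
    · rw [indicator_of_mem hp, indicator_of_mem hp]
    · rw [indicator_of_notMem hp, indicator_of_notMem hp, zero_mul]
  rw [e', integral_indicator (isOpen_tiltedPlaquette r).measurableSet, integral_const_mul,
    integral_add (hint hD₁) (hint hD₂)] at e
  have := mul_le_mul_of_nonneg_left (add_le_add i₁ i₂) hc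
  linarith

theorem anisoTV_plateau_le {c r : ℝ} (hc : 0 ≤ c) (hr0 : 0 ≤ r) (hr : r ≤ 1) :
    anisoTV crysNorm (plateau c r) ≤ ENNReal.ofReal (c * (4 - 4 * r)) :=
  iSup₂_le fun _ hη =>
    ENNReal.ofReal_le_ofReal (integral_plateau_mul_diverg_le hc hr0 hr hη.1 hη.2.2)

theorem measurableSet_tilt_symm_preimage (r : ℝ) :
    MeasurableSet (tilt.symm ⁻¹' tiltedPlaquette r) :=
  ((isOpen_tiltedPlaquette r).preimage tilt.symm.continuous).measurableSet

theorem tilt_symm_preimage_subset (r : ℝ) :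
    tilt.symm ⁻¹' tiltedPlaquette r ⊆ unitSquare := fun x hx => by
  rw [← tilt.apply_symm_apply x, tilt_mem_unitSquare]
  exact hx.2.2

theorem measureReal_tilt_symm_preimage {r : ℝ} (hr0 : 0 ≤ r) (hr : r ≤ 1 / 2) :
    volume.real (tilt.symm ⁻¹' tiltedPlaquette r) = 1 - 2 * r ^ 2 := by
  have h := measureReal_tiltedPlaquette hr0 hr
  have : tiltedPlaquette r = tilt ⁻¹' (tilt.symm ⁻¹' tiltedPlaquette r) := by
    ext p
    simp
  rw [this, measureReal_def, volume_tilt_preimage, toReal_mul, ← measureReal_def,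
    toReal_ofNat] at h
  linarith

theorem volume_unitSquare : volume unitSquare = 1 := by
  simp [unitSquare, Real.volume_pi_Ioo]

theorem admissible_plateau {m r : ℝ} (n : ℕ) (hr0 : 0 ≤ r) (hr : r ≤ 1 / 2)
    (hm : n * (1 - 2 * r ^ 2) = m) : Admissible crysNorm unitSquare m (plateau n r) := by
  have hK := measurableSet_tilt_symm_preimage r
  have hKs := tilt_symm_preimage_subset r
  refine ⟨⟨?_, ?_⟩, ae_of_all _ fun x hx => ?_, ae_of_all _ fun x => ?_, ?_⟩
  · refine (integrable_indicator_iff hK).2 (integrableOn_const ?_)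
    exact ((measure_mono hKs).trans_lt (by simp [volume_unitSquare])).ne
  · exact ((anisoTV_plateau_le n.cast_nonneg hr0 (by linarith)).trans_lt ofReal_lt_top).ne
  · exact indicator_of_notMem (fun h => hx (hKs h)) _
  · by_cases h : x ∈ tilt.symm ⁻¹' tiltedPlaquette r
    · exact ⟨n, indicator_of_mem h _⟩
    · exact ⟨0, (indicator_of_notMem h _).trans Nat.cast_zero.symm⟩
  · rw [plateau, setIntegral_indicator hK, inter_eq_self_of_subset_right hKs, setIntegral_const,
      measureReal_tilt_symm_preimage hr0 hr, smul_eq_mul, mul_comm, hm]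

theorem densityPoints_congr {n : ℕ} {E F : Set (Fin n → ℝ)} (h : E =ᵐ[volume] F) :
    densityPoints E = densityPoints F := by
  have : ∀ x r, volume (E ∩ Metric.ball x r) = volume (F ∩ Metric.ball x r) := fun x r =>
    measure_congr (h.inter (ae_eq_refl _))
  simp only [densityPoints, this]

theorem subset_densityPoints_of_isOpen {n : ℕ} {E : Set (Fin n → ℝ)} (hE : IsOpen E) :
    E ⊆ densityPoints E := by
  intro x hx
  obtain ⟨ε, hε, hb⟩ := Metric.isOpen_iff.1 hE x hx
  refine tendsto_const_nhds.congr' ?_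
  filter_upwards [Ioo_mem_nhdsGT hε] with r hr
  rw [inter_eq_self_of_subset_right ((Metric.ball_subset_ball hr.2.le).trans hb),
    ENNReal.div_self (Metric.measure_ball_pos volume x hr.1).ne' measure_ball_lt_top.ne]

theorem densityPoints_subset_closure {n : ℕ} (E : Set (Fin n → ℝ)) :
    densityPoints E ⊆ closure E := by
  intro x hx
  by_contra hxc
  obtain ⟨ε, hε, hb⟩ := Metric.isOpen_iff.1 isClosed_closure.isOpen_compl x hxc
  have h0 : Tendsto (fun r : ℝ => volume (E ∩ Metric.ball x r) / volume (Metric.ball x r))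
      (nhdsWithin 0 (Ioi 0)) (nhds 0) := by
    refine tendsto_const_nhds.congr' ?_
    filter_upwards [Ioo_mem_nhdsGT hε] with r hr
    have : E ∩ Metric.ball x r = ∅ := by
      rw [← disjoint_iff_inter_eq_empty, disjoint_left]
      exact fun y hy hyb => hb (Metric.ball_subset_ball hr.2.le hyb) (subset_closure hy)
    rw [this, measure_empty, ENNReal.zero_div]
  exact one_ne_zero (tendsto_nhds_unique hx h0)

theorem closure_densityPoints_of_ae_eq {n : ℕ} {E K : Set (Fin n → ℝ)} (h : E =ᵐ[volume] K)
    (hK : IsOpen K) : closure (densityPoints E) = closure K := by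
  rw [densityPoints_congr h]
  exact (closure_minimal (densityPoints_subset_closure K) isClosed_closure).antisymm
    (closure_mono (subset_densityPoints_of_isOpen hK))

theorem crysNorm_tilt_sub (p q : ℝ × ℝ) :
    crysNorm (tilt p - tilt q) = max |p.1 - q.1| |p.2 - q.2| := by
  simp only [crysNorm, tilt_apply, Pi.sub_apply, Matrix.cons_val_zero, Matrix.cons_val_one]
  rcases abs_cases ((1 + p.1 + p.2) / 2 - (1 + q.1 + q.2) / 2) with h | h <;>
    rcases abs_cases ((1 + p.1 - p.2) / 2 - (1 + q.1 - q.2) / 2) with h' | h' <;>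
    rcases abs_cases (p.1 - q.1) with h1 | h1 <;>
    rcases abs_cases (p.2 - q.2) with h2 | h2 <;>
    rcases max_cases |p.1 - q.1| |p.2 - q.2| with h3 | h3 <;> linarith

theorem mem_wulffBall_tilt {p q : ℝ × ℝ} {r : ℝ} :
    tilt p ∈ wulffBall crysNorm (tilt q) r ↔ |p.1 - q.1| < r ∧ |p.2 - q.2| < r := by
  rw [wulffBall, mem_ofPred_eq, crysNorm_tilt_sub, max_lt_iff]

theorem wulffBall_subset_unitSquare_iff {q : ℝ × ℝ} {r : ℝ} (hr : 0 < r) :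
    wulffBall crysNorm (tilt q) r ⊆ unitSquare ↔ |q.1| + |q.2| ≤ 1 - 2 * r := by
  constructor
  · intro h
    refine le_of_forall_pos_lt_add fun ε hε => ?_
    set δ := min (r / 2) (ε / 2)
    have hδ : 0 < δ := by positivity
    have hδr : δ ≤ r / 2 := min_le_left _ _
    have hδε : δ ≤ ε / 2 := min_le_right _ _
    have key : ∀ x : ℝ, ∃ y, |y - x| < r ∧ |y| = |x| + (r - δ) := fun x => by
      rcases le_total 0 x with hx | hx
      · refine ⟨x + (r - δ), ?_, ?_⟩
        · rw [abs_lt]; constructor <;> linarith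
        · rw [abs_of_nonneg hx, abs_of_nonneg (by linarith)]
      · refine ⟨x - (r - δ), ?_, ?_⟩
        · rw [abs_lt]; constructor <;> linarith
        · rw [abs_of_nonpos hx, abs_of_nonpos (by linarith)]; ring
    obtain ⟨s, hs, hs'⟩ := key q.1
    obtain ⟨t, ht, ht'⟩ := key q.2
    have := tilt_mem_unitSquare.1 (h (mem_wulffBall_tilt (p := (s, t)) |>.2 ⟨hs, ht⟩))
    simp only [hs', ht'] at this
    linarith
  · intro h x hx
    obtain ⟨p, rfl⟩ := tilt.surjective x
    obtain ⟨h1, h2⟩ := mem_wulffBall_tilt.1 hx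
    rw [tilt_mem_unitSquare]
    have := abs_sub_abs_le_abs_sub p.1 q.1
    have := abs_sub_abs_le_abs_sub p.2 q.2
    linarith

theorem plaquette_unitSquare {r : ℝ} (hr0 : 0 ≤ r) (hr : r < 1 / 2) :
    plaquette crysNorm unitSquare r = tilt.symm ⁻¹' tiltedPlaquette r := by
  ext x
  obtain ⟨p, rfl⟩ := tilt.surjective x
  rw [mem_preimage, tilt.symm_apply_apply, plaquette]
  split_ifs with h0
  · subst h0
    rw [tilt_mem_unitSquare]
    simp only [tiltedPlaquette, mem_ofPred_eq]
    have := abs_nonneg p.1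
    have := abs_nonneg p.2
    constructor
    · intro h; refine ⟨?_, ?_, h⟩ <;> linarith
    · exact fun h => h.2.2
  · have hrpos : 0 < r := lt_of_le_of_ne hr0 (Ne.symm h0)
    simp only [mem_iUnion, tilt.surjective.exists, exists_prop,
      wulffBall_subset_unitSquare_iff hrpos, mem_wulffBall_tilt, tiltedPlaquette, mem_ofPred_eq]
    constructor
    · rintro ⟨q, hq, h1, h2⟩
      have := abs_sub_abs_le_abs_sub p.1 q.1
      have := abs_sub_abs_le_abs_sub p.2 q.2
      have := abs_nonneg q.1
      have := abs_nonneg q.2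
      refine ⟨?_, ?_, ?_⟩ <;> linarith
    · rintro ⟨h1, h2, h3⟩
      have key : ∀ x d : ℝ, 0 ≤ d → d < r → ∃ y, |x - y| < r ∧ |y| ≤ max 0 (|x| - d) := by
        intro x d hd hdr
        rcases le_or_gt |x| d with hx | hx
        · exact ⟨0, by rw [sub_zero]; linarith, by simp⟩
        · rcases le_total 0 x with h | h
          · rw [abs_of_nonneg h] at hx
            refine ⟨x - d, by rwa [_root_.sub_sub_cancel, abs_of_nonneg hd], ?_⟩
            rw [abs_of_nonneg h, abs_of_nonneg (by linarith)]
            exact le_max_right _ _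
          · rw [abs_of_nonpos h] at hx
            refine ⟨x + d, ?_, ?_⟩
            · rwa [sub_add_cancel_left, abs_neg, abs_of_nonneg hd]
            · rw [abs_of_nonpos h, abs_of_nonpos (by linarith)]
              exact (le_of_eq (by ring)).trans (le_max_right _ _)
      set e := min (min (1 - r - |p.1|) (1 - r - |p.2|)) (min ((1 - |p.1| - |p.2|) / 2) r) / 2
      have he : 0 < min (min (1 - r - |p.1|) (1 - r - |p.2|))
          (min ((1 - |p.1| - |p.2|) / 2) r) := by
        refine lt_min (lt_min ?_ ?_) (lt_min ?_ hrpos) <;> linarith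
      have e1 : 2 * e ≤ 1 - r - |p.1| := by
        rw [mul_div_cancel₀ _ two_ne_zero]
        exact (min_le_left _ _).trans (min_le_left _ _)
      have e2 : 2 * e ≤ 1 - r - |p.2| := by
        rw [mul_div_cancel₀ _ two_ne_zero]
        exact (min_le_left _ _).trans (min_le_right _ _)
      have e3 : 2 * e ≤ (1 - |p.1| - |p.2|) / 2 := by
        rw [mul_div_cancel₀ _ two_ne_zero]
        exact (min_le_right _ _).trans (min_le_left _ _)
      have e4 : 2 * e ≤ r := by
        rw [mul_div_cancel₀ _ two_ne_zero]
        exact (min_le_right _ _).trans (min_le_right _ _)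
      have e5 : 0 < e := half_pos he
      obtain ⟨s, hs, hs'⟩ := key p.1 (r - e) (by linarith) (by linarith)
      obtain ⟨t, ht, ht'⟩ := key p.2 (r - e) (by linarith) (by linarith)
      refine ⟨(s, t), ?_, hs, ht⟩
      rcases max_cases 0 (|p.1| - (r - e)) with h | h <;>
        rcases max_cases 0 (|p.2| - (r - e)) with h' | h' <;> simp only <;> linarith

/-- The superlevel set `{u ≥ j + 1}` of `u` in the unit square. -/
def levelSet (u : (Fin 2 → ℝ) → ℝ) (j : ℕ) : Set (Fin 2 → ℝ) :=
  unitSquare ∩ {x | (j : ℝ) + 1 ≤ u x}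

theorem measurableSet_unitSquare : MeasurableSet unitSquare :=
  MeasurableSet.univ_pi fun _ => measurableSet_Ioo

theorem measurableSet_levelSet {u : (Fin 2 → ℝ) → ℝ} (hu : Measurable u) (j : ℕ) :
    MeasurableSet (levelSet u j) :=
  measurableSet_unitSquare.inter (measurableSet_le measurable_const hu)

theorem levelSet_antitone (u : (Fin 2 → ℝ) → ℝ) : Antitone (levelSet u) := by
  intro i j hij x hx
  have h : (j : ℝ) + 1 ≤ u x := hx.2
  have h' : (i : ℝ) ≤ j := by exact_mod_cast hij
  exact ⟨hx.1, show (i : ℝ) + 1 ≤ u x by linarith⟩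

theorem eq_sum_levelSet {u : (Fin 2 → ℝ) → ℝ} {N : ℕ} {x : Fin 2 → ℝ}
    (h0 : x ∉ unitSquare → u x = 0) (hk : ∃ k : ℕ, u x = k) (hN : u x ≤ N) :
    u x = ∑ j ∈ Finset.range N, (levelSet u j).indicator (fun _ => (1 : ℝ)) x := by
  by_cases hx : x ∈ unitSquare
  · obtain ⟨k, hk⟩ := hk
    have hkN : k ≤ N := by
      rw [hk] at hN
      exact_mod_cast hN
    have : ∀ j ∈ Finset.range N, (levelSet u j).indicator (fun _ => (1 : ℝ)) x =
        if j < k then 1 else 0 := by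
      intro j _
      have hmem : x ∈ levelSet u j ↔ j < k := by
        simp only [levelSet, mem_inter_iff, hx, true_and, mem_ofPred_eq, hk]
        rw [Nat.lt_iff_add_one_le]
        exact_mod_cast Iff.rfl
      split_ifs with h
      · exact indicator_of_mem (hmem.2 h) _
      · exact indicator_of_notMem (mt hmem.1 h) _
    rw [Finset.sum_congr rfl this, ← Finset.sum_filter, Finset.sum_const, nsmul_one, hk]
    congr 1
    have : (Finset.range N).filter (· < k) = Finset.range k := by
      ext j
      simp only [Finset.mem_filter, Finset.mem_range]
      omega
    rw [this, Finset.card_range]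
  · rw [h0 hx, Finset.sum_eq_zero]
    exact fun j _ => indicator_of_notMem (fun h => hx h.1) _

theorem measure_levelSet_pos {u : (Fin 2 → ℝ) → ℝ}
    (h0 : ∀ᵐ x, x ∉ unitSquare → u x = 0) (hk : ∀ᵐ x, ∃ k : ℕ, u x = k)
    {N : ℕ} (hN : IsEssSup u N) {j : ℕ} (hj : j < N) :
    0 < volume (levelSet u j) := by
  rw [pos_iff_ne_zero]
  intro hz
  have hle : ∀ᵐ x, u x ≤ ((N - 1 : ℕ) : ℝ) := by
    have hz' : ∀ᵐ x, x ∉ levelSet u j := measure_eq_zero_iff_ae_notMem.1 hz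
    filter_upwards [h0, hk, hz'] with x h0x ⟨k, hkx⟩ hzx
    by_cases hx : x ∈ unitSquare
    · have : ¬ ((j : ℝ) + 1 ≤ u x) := fun h => hzx ⟨hx, h⟩
      rw [hkx] at this ⊢
      have h' : ¬ (j + 1 ≤ k) := fun h => this (by exact_mod_cast h)
      exact_mod_cast (by omega : k ≤ N - 1)
    · rw [h0x hx]
      positivity
  have := hN.2 _ hle
  have : N ≤ N - 1 := by exact_mod_cast this
  omega

theorem isMinimizer_congr_measurable {m : ℝ} {u : (Fin 2 → ℝ) → ℝ} {N : ℕ}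
    (hu : IsMinimizer crysNorm unitSquare m u) (hN : IsEssSup u N) :
    ∃ v, Measurable v ∧ u =ᵐ[volume] v ∧ IsMinimizer crysNorm unitSquare m v ∧ IsEssSup v N := by
  obtain ⟨⟨⟨hi, htv⟩, h0, hk, hI⟩, hmin⟩ := hu
  set v := hi.1.mk u
  have huv : u =ᵐ[volume] v := hi.1.ae_eq_mk
  have htv' : anisoTV crysNorm u = anisoTV crysNorm v := by
    refine iSup_congr fun η => iSup_congr fun _ => congrArg ENNReal.ofReal (integral_congr_ae ?_)
    filter_upwards [huv] with x hx
    rw [hx]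
  refine ⟨v, hi.1.stronglyMeasurable_mk.measurable, huv, ⟨⟨⟨hi.congr huv, htv' ▸ htv⟩, ?_, ?_, ?_⟩,
    htv' ▸ hmin⟩, ?_, fun c hc => hN.2 c ?_⟩
  · filter_upwards [h0, huv] with x hx h
    rwa [← h]
  · filter_upwards [hk, huv] with x hx h
    rwa [← h]
  · rw [← hI]
    exact integral_congr_ae (ae_restrict_of_ae huv.symm)
  · filter_upwards [hN.1, huv] with x hx h
    rwa [← h]
  · filter_upwards [hc, huv] with x hx h
    rwa [h]

theorem anisoTV_le_of_isMinimizer {m : ℝ} (hm : 0 < m) {u : (Fin 2 → ℝ) → ℝ}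
    (hu : IsMinimizer crysNorm unitSquare m u) (n : ℕ) (h1 : m ≤ n) (h2 : n ≤ 2 * m) :
    anisoTV crysNorm u ≤ ENNReal.ofReal (n * (4 - 4 * Real.sqrt ((1 - m / n) / 2))) := by
  have hn : (0 : ℝ) < n := hm.trans_le h1
  have hr := sqrt_rollRadius_le_half hn h2
  refine (hu.2 _ (admissible_plateau n (Real.sqrt_nonneg _) hr ?_)).trans
    (anisoTV_plateau_le n.cast_nonneg (Real.sqrt_nonneg _) (by linarith))
  rw [sq_sqrt_rollRadius hn h1]
  field_simp
  ring

theorem levelSet_ae_eq {m : ℝ} (hm : 1 < m) {u : (Fin 2 → ℝ) → ℝ} (hum : Measurable u)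
    (hu : IsMinimizer crysNorm unitSquare m u) {N : ℕ} (hN : IsEssSup u N) :
    Real.sqrt ((1 - m / N) / 2) < 1 / 2 ∧
      (N - 1 : ℝ) ≤ (1 + Real.sqrt 2) / 2 * m ∧ (1 + Real.sqrt 2) / 2 * m < N + 1 ∧
      ∀ j < N, levelSet u j =ᵐ[volume]
        tilt.symm ⁻¹' tiltedPlaquette (Real.sqrt ((1 - m / N) / 2)) := by
  obtain ⟨⟨⟨hi, htv⟩, h0, hk, hI⟩, hmin⟩ := id hu
  set A := levelSet u
  have hAm : ∀ j, MeasurableSet (A j) := measurableSet_levelSet hum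
  have hAs : ∀ j, A j ⊆ unitSquare := fun j => inter_subset_left
  have hsum : ∀ᵐ x, u x = ∑ j ∈ Finset.range N, (A j).indicator (fun _ => (1 : ℝ)) x := by
    filter_upwards [h0, hk, hN.1] with x h0x hkx hNx using eq_sum_levelSet h0x hkx hNx
  have hfin : ∀ j, volume (A j) ≠ ⊤ := fun j =>
    ((measure_mono (hAs j)).trans_lt (by simp [volume_unitSquare])).ne
  have htm : ∀ j, MeasurableSet (tilt ⁻¹' A j) := fun j => tilt.continuous.measurable (hAm j)
  have hts : ∀ j, ∀ p ∈ tilt ⁻¹' A j, |p.1| + |p.2| < 1 := fun j p hp =>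
    abs_add_abs_lt_of_mem (hAs j) hp
  have htv2 : ∀ j, volume.real (tilt ⁻¹' A j) = 2 * volume.real (A j) := fun j => by
    rw [measureReal_def, volume_tilt_preimage, toReal_mul, ← measureReal_def, toReal_ofNat]
  set p : ℕ → ℝ := fun j => meanShadow (tilt ⁻¹' A j)
  have harea : ∀ j, volume.real (A j) ≤ areaProfile (p j) := fun j => by
    have := measureReal_le_areaProfile (htm j) (hts j)
    rw [htv2] at this
    linarith
  have hmass : ∑ j ∈ Finset.range N, volume.real (A j) = m := by
    rw [← hI, setIntegral_eq_integral_of_ae_compl_eq_zero h0, integral_congr_ae hsum,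
      integral_finsetSum _ fun j _ =>
        (integrable_indicator_iff (hAm j)).2 (integrableOn_const (hfin j))]
    refine Finset.sum_congr rfl fun j _ => ?_
    rw [integral_indicator (hAm j), setIntegral_const, smul_eq_mul, mul_one]
  have hpos : ∀ j < N, 0 < volume.real (A j) := fun j hj =>
    toReal_pos (measure_levelSet_pos h0 hk hN hj).ne' (hfin j)
  have hp : ∀ j < N, 0 < p j ∧ p j ≤ 1 := fun j hj => by
    refine ⟨lt_of_le_of_ne (meanShadow_nonneg _) fun h => ?_, meanShadow_le_one (hts j)⟩
    have h1 := hpos j hj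
    have h2 := harea j
    rw [← h, areaProfile_of_lt (by norm_num)] at h2
    norm_num at h2
    linarith
  have hTV : ∀ {T : ℝ}, anisoTV crysNorm u ≤ ENNReal.ofReal (4 * T) → 0 ≤ T →
      ∑ j ∈ Finset.range N, p j ≤ T := by
    intro T hT hT0
    have h := (sum_measure_shadow_le_anisoTV hi hAm (levelSet_antitone u) hAs hsum).trans hT
    have e : ENNReal.ofReal (4 * ∑ j ∈ Finset.range N, p j) = ∑ j ∈ Finset.range N,
        (volume (shadow (tilt ⁻¹' A j)) +
          volume (shadow (Prod.swap ⁻¹' (tilt ⁻¹' A j)))) := by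
      rw [Finset.mul_sum, ENNReal.ofReal_sum_of_nonneg fun j _ =>
        mul_nonneg (by norm_num) (meanShadow_nonneg _)]
      refine Finset.sum_congr rfl fun j _ => ?_
      have t1 := measure_shadow_ne_top (hts j)
      have t2 := measure_shadow_ne_top (forall_mem_swap_preimage (hts j))
      simp only [meanShadow]
      rw [mul_div_cancel₀ _ (by norm_num), ENNReal.ofReal_add measureReal_nonneg
        measureReal_nonneg, ofReal_measureReal t1, ofReal_measureReal t2]
    rw [← e, ENNReal.ofReal_le_ofReal_iff (by linarith)] at h
    linarith
  have hF : ∀ n : ℕ, m ≤ n → n ≤ 2 * m →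
      ∑ j ∈ Finset.range N, p j ≤ n * (1 - Real.sqrt ((1 - m / n) / 2)) := fun n h1 h2 => by
    have hr := sqrt_rollRadius_le_half (show (0 : ℝ) < n by linarith) h2
    refine hTV ?_ (mul_nonneg n.cast_nonneg (by linarith))
    convert anisoTV_le_of_isMinimizer (by linarith) hu n h1 h2 using 2
    ring
  have hcard : ((Multiset.range N).map p).card = N := by simp
  have hmap : (((Multiset.range N).map p).map areaProfile).sum =
      ∑ j ∈ Finset.range N, areaProfile (p j) := by
    rw [Multiset.map_map]
    rfl
  obtain ⟨g1, g2, g3, g4, g5⟩ := level_structure hm hF ((Multiset.range N).map p)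
    (fun q hq => by
      obtain ⟨j, hj, rfl⟩ := Multiset.mem_map.1 hq
      exact hp j (Multiset.mem_range.1 hj)) rfl
    (by
      rw [hmap, ← hmass]
      exact Finset.sum_le_sum fun j _ => harea j)
  rw [hcard] at g2 g3 g4 g5
  rw [hmap, ← hmass, eq_comm, Finset.sum_eq_sum_iff_of_le fun j _ => harea j] at g1
  refine ⟨g2, g4, g5, fun j hj => ?_⟩
  have hpj := g3 (p j) (Multiset.mem_map_of_mem _ (Multiset.mem_range.2 hj))
  have hV := g1 j (Finset.mem_range.2 hj)
  rw [hpj, areaProfile_of_le (by linarith), _root_.sub_sub_cancel] at hV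
  have hae := ae_eq_tiltedPlaquette (htm j) (hts j) g2 hpj (by rw [htv2, hV]; ring)
  refine eventuallyEq_set.2 (ae_tilt_iff.1 ?_)
  filter_upwards [eventuallyEq_set.1 hae] with q hq
  simpa using hq

/-- Minimizers of problem (1) in the unit square with the
crystalline norm `φ(ν) = |ν₁| + |ν₂|`, for `m > 1` (case (iv)): the number of levels
is `⌊(1+√2)/2·m⌋` or `⌊(1+√2)/2·m⌋ + 1`, and all level sets are the plaquette `Ω^r`
with `r = √((1 − m/j̄)/2)`. -/
theorem square_crystalline_large_mass (m : ℝ) (hm : 1 < m)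
    (u : (Fin 2 → ℝ) → ℝ) (hu : IsMinimizer crysNorm unitSquare m u)
    (jbar : ℕ) (hjbar : IsEssSup u jbar) :
    ((jbar : ℤ) = ⌊(1 + Real.sqrt 2) / 2 * m⌋ ∨
      (jbar : ℤ) = ⌊(1 + Real.sqrt 2) / 2 * m⌋ + 1) ∧
    ∀ j : ℕ, 1 ≤ j → j ≤ jbar →
      closure (densityPoints {x | (j : ℝ) ≤ u x}) =
        closure (plaquette crysNorm unitSquare
          (Real.sqrt ((1 - m / (jbar : ℝ)) / 2))) := by
  obtain ⟨v, hvm, huv, hv, hvN⟩ := isMinimizer_congr_measurable hu hjbar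
  obtain ⟨hr, hlo, hhi, hlevel⟩ := levelSet_ae_eq hm hvm hv hvN
  refine ⟨?_, fun j hj1 hj => ?_⟩
  · have h1 : (jbar : ℤ) - 1 ≤ ⌊(1 + Real.sqrt 2) / 2 * m⌋ :=
      Int.le_floor.2 (by push_cast; exact hlo)
    have h2 : ⌊(1 + Real.sqrt 2) / 2 * m⌋ < (jbar : ℤ) + 1 :=
      Int.floor_lt.2 (by push_cast; exact hhi)
    omega
  · rw [plaquette_unitSquare (Real.sqrt_nonneg _) hr]
    refine closure_densityPoints_of_ae_eq ?_
      ((isOpen_tiltedPlaquette _).preimage tilt.symm.continuous)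
    refine EventuallyEq.trans (eventuallyEq_set.2 ?_) (hlevel (j - 1) (by omega))
    filter_upwards [huv, hv.1.2.1] with x hx h0
    have hj' : ((j - 1 : ℕ) : ℝ) + 1 = j := by
      exact_mod_cast Nat.sub_add_cancel hj1
    simp only [levelSet, mem_inter_iff, mem_ofPred_eq, hj', hx]
    refine ⟨fun h => ⟨?_, h⟩, fun h => h.2⟩
    by_contra hxs
    rw [h0 hxs] at h
    have : (1 : ℝ) ≤ j := by exact_mod_cast hj1
    linarith

end
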